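/- arXiv:1504.03444 — 4 statements merged into one kernel-verified Lean document; each statement's English description precedes it below -/
import Mathlib

section
/- There is an absolute constant C such that for every finite field 𝔽_q with q odd, every integer n ≥ 1, and every nonzero J ∈ 𝔽_q[t] with deg J < n: |Σ_{f∈M_n} μ²(f)·μ²(f+J) − 𝔖(J)·q^n| ≤ C·n·q^{2n/3}, where 𝔖(J) = ∏_P (1 − 2/|P|²) · ∏_{P : P²∣J} (|P|²−1)/(|P|²−2), the products running over monic irreducible polynomials P ∈ 𝔽_q[t] and |P| = q^{deg P}. -/
open Polynomial

/-- The singular series `𝔖(J) = ∏_P (1 - 2/|P|²) · ∏_{P² ∣ J} (|P|²-1)/(|P|²-2)`, the products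
running over monic irreducible polynomials `P ∈ 𝔽_q[t]`, with `|P| = q^{deg P}`. -/
noncomputable def singSeries {Fq : Type} [Field Fq] [Fintype Fq] (J : Fq[X]) : ℝ :=
  (∏' P : {P : Fq[X] // P.Monic ∧ Irreducible P},
      (1 - 2 / ((Fintype.card Fq : ℝ) ^ (P : Fq[X]).natDegree) ^ 2)) *
    ∏ᶠ P ∈ {P : Fq[X] | P.Monic ∧ Irreducible P ∧ P ^ 2 ∣ J},
      ((((Fintype.card Fq : ℝ) ^ P.natDegree) ^ 2 - 1) /
        (((Fintype.card Fq : ℝ) ^ P.natDegree) ^ 2 - 2))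

section aux
set_option linter.unusedSectionVars false
open scoped Classical
variable {F : Type} [Field F] [Fintype F]

lemma monSet_finite (n : ℕ) : {f : F[X] | f.Monic ∧ f.natDegree = n}.Finite := by
  have : Finite (degreeLT F n) := Finite.of_equiv _ (degreeLTEquiv F n).toEquiv.symm
  have : Finite {f : F[X] | f.Monic ∧ f.natDegree = n} :=
    Finite.of_equiv _ (monicEquivDegreeLT (R := F) n).symm
  exact Set.toFinite _

variable (F) in
noncomputable def Mn (n : ℕ) : Finset F[X] := (monSet_finite (F := F) n).toFinset

lemma mem_Mn {n : ℕ} {f : F[X]} : f ∈ Mn F n ↔ f.Monic ∧ f.natDegree = n := by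
  simp [Mn]

lemma card_Mn (n : ℕ) : (Mn F n).card = Fintype.card F ^ n := by
  have h1 : Nat.card { p : F[X] // p.Monic ∧ p.natDegree = n } = (Mn F n).card := by
    rw [Nat.subtype_card]
    exact fun x => mem_Mn
  rw [← h1, Nat.card_congr (monicEquivDegreeLT (R := F) n), Nat.card_congr (degreeLTEquiv F n).toEquiv]
  simp

lemma card_modEq_le (n : ℕ) (M f0 : F[X]) (h : n < M.natDegree) :
    ((Mn F n).filter (fun f => M ∣ f - f0)).card ≤ 1 := by
  rw [Finset.card_le_one]
  intro a ha b hb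
  simp only [Finset.mem_filter, mem_Mn] at ha hb
  have h1 : M ∣ a - b := by
    have := dvd_sub ha.2 hb.2
    simpa using this
  by_contra hne
  have h2 := natDegree_le_of_dvd h1 (sub_ne_zero.mpr hne)
  have h3 := natDegree_sub_le a b
  rw [ha.1.2, hb.1.2] at h3
  simp at h3
  omega

lemma card_modEq (n : ℕ) (M f0 : F[X]) (hM : M.Monic) (h : M.natDegree ≤ n) :
    ((Mn F n).filter (fun f => M ∣ f - f0)).card = Fintype.card F ^ (n - M.natDegree) := by
  rw [← card_Mn]
  symm
  have hr : (f0 %ₘ M).degree < M.degree := degree_modByMonic_lt _ hM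
  refine Finset.card_bij (fun g _ => f0 %ₘ M + M * g) ?_ ?_ ?_
  · intro g hg
    rw [mem_Mn] at hg
    have hm : (M * g).Monic := hM.mul hg.1
    have hd : (M * g).natDegree = n := by
      rw [hM.natDegree_mul hg.1, hg.2]; omega
    have hlt : (f0 %ₘ M).degree < (M * g).degree := by
      refine lt_of_lt_of_le hr ?_
      rw [degree_eq_natDegree hM.ne_zero, degree_eq_natDegree hm.ne_zero, hd]
      exact_mod_cast h
    rw [Finset.mem_filter, mem_Mn]
    refine ⟨⟨hm.add_of_right hlt, ?_⟩, ?_⟩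
    · rw [natDegree_add_eq_right_of_degree_lt hlt, hd]
    · have := modByMonic_add_div f0 M
      refine ⟨g - f0 /ₘ M, ?_⟩
      linear_combination this
  · intro a _ b _ hab
    exact mul_left_cancel₀ hM.ne_zero (add_left_cancel hab)
  · intro f hf
    rw [Finset.mem_filter, mem_Mn] at hf
    obtain ⟨⟨hfm, hfd⟩, c, hc⟩ := hf
    have := modByMonic_add_div f0 M
    have e : f0 %ₘ M + M * (c + f0 /ₘ M) = f := by linear_combination this - hc
    have hlt : (f0 %ₘ M).degree < f.degree := by
      refine lt_of_lt_of_le hr ?_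
      rw [degree_eq_natDegree hM.ne_zero, degree_eq_natDegree hfm.ne_zero, hfd]
      exact_mod_cast h
    have e2 : M * (c + f0 /ₘ M) = f - f0 %ₘ M := by linear_combination e
    have hm : (M * (c + f0 /ₘ M)).Monic := by
      rw [e2]; exact hfm.sub_of_left hlt
    have hd : (M * (c + f0 /ₘ M)).natDegree = n := by
      rw [e2, natDegree_eq_of_degree_eq (degree_sub_eq_left_of_degree_lt hlt), hfd]
    have hg := hM.of_mul_monic_left hm
    refine ⟨_, ?_, e⟩
    rw [mem_Mn]
    refine ⟨hg, ?_⟩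
    rw [hM.natDegree_mul hg] at hd
    omega


/-- total degree of a finite set of polynomials -/
noncomputable def DD (A : Finset F[X]) : ℕ := ∑ P ∈ A, P.natDegree

lemma coprime_of {P Q : F[X]} (hP : P.Monic ∧ Irreducible P) (hQ : Q.Monic ∧ Irreducible Q)
    (h : P ≠ Q) : IsCoprime P Q := by
  by_cases h1 : P ∣ Q
  swap
  · exact hP.2.coprime_iff_not_dvd.mpr h1
  · exact absurd (eq_of_monic_of_associated hP.1 hQ.1
      ((hP.2.dvd_irreducible_iff_associated hQ.2).mp h1)) h

lemma prod_monic {A : Finset F[X]} (hA : ∀ P ∈ A, P.Monic ∧ Irreducible P) :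
    (∏ P ∈ A, P ^ 2).Monic := monic_prod_of_monic _ _ fun P hP => (hA P hP).1.pow 2

lemma prod_deg {A : Finset F[X]} (hA : ∀ P ∈ A, P.Monic ∧ Irreducible P) :
    (∏ P ∈ A, P ^ 2).natDegree = 2 * DD A := by
  rw [natDegree_prod_of_monic _ _ fun P hP => (hA P hP).1.pow 2, DD, Finset.mul_sum]
  simp [natDegree_pow]

lemma prod_dvd {A : Finset F[X]} (hA : ∀ P ∈ A, P.Monic ∧ Irreducible P) (f : F[X]) :
    (∏ P ∈ A, P ^ 2) ∣ f ↔ ∀ P ∈ A, P ^ 2 ∣ f := by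
  constructor
  · intro h P hP
    exact (Finset.dvd_prod_of_mem (fun P : F[X] => P ^ 2) hP).trans h
  · intro h
    refine Finset.prod_dvd_of_coprime ?_ h
    intro P hP Q hQ hne
    exact (coprime_of (hA P hP) (hA Q hQ) hne).pow

lemma card_pos_F : (1 : ℝ) < (Fintype.card F : ℝ) := by
  exact_mod_cast Fintype.one_lt_card

lemma count_single (n : ℕ) {A : Finset F[X]} (hA : ∀ P ∈ A, P.Monic ∧ Irreducible P) :
    (((Mn F n).filter (fun f => ∀ P ∈ A, P ^ 2 ∣ f)).card : ℝ) ≤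
      (Fintype.card F : ℝ) ^ n * ((Fintype.card F : ℝ)⁻¹) ^ (2 * DD A) := by
  have hq := card_pos_F (F := F)
  have hq0 : (Fintype.card F : ℝ) ≠ 0 := by positivity
  by_cases h : 2 * DD A ≤ n
  · have := card_modEq n (∏ P ∈ A, P ^ 2) 0 (prod_monic hA) (by rw [prod_deg hA]; exact h)
    simp only [sub_zero, prod_dvd hA, prod_deg hA] at this
    rw [this]
    push_cast
    rw [inv_pow, pow_sub₀ _ hq0 h]
  · have : (Mn F n).filter (fun f => ∀ P ∈ A, P ^ 2 ∣ f) = ∅ := by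
      rw [Finset.filter_eq_empty_iff]
      intro f hf h2
      rw [mem_Mn] at hf
      rw [← prod_dvd hA] at h2
      have := natDegree_le_of_dvd h2 hf.1.ne_zero
      rw [prod_deg hA] at this
      omega
    rw [this]
    simp
    positivity

lemma count_pair (n : ℕ) (J : F[X]) {A B : Finset F[X]}
    (hA : ∀ P ∈ A, P.Monic ∧ Irreducible P) (hB : ∀ P ∈ B, P.Monic ∧ Irreducible P) :
    |(((Mn F n).filter (fun f => (∀ P ∈ A, P ^ 2 ∣ f) ∧ ∀ P ∈ B, P ^ 2 ∣ f + J)).card : ℝ) -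
      (if ∀ P ∈ A ∩ B, P ^ 2 ∣ J then 1 else 0) *
      ((Fintype.card F : ℝ) ^ n * ((Fintype.card F : ℝ)⁻¹) ^ (2 * DD (A ∪ B)))| ≤ 1 := by
  have hq := card_pos_F (F := F)
  have hq0 : (Fintype.card F : ℝ) ≠ 0 := by positivity
  have hAB : ∀ P ∈ A ∪ B, P.Monic ∧ Irreducible P := by
    intro P hP
    rcases Finset.mem_union.mp hP with h | h
    exacts [hA P h, hB P h]
  split_ifs with hJ
  · have hex : ∃ f0 : F[X], ∀ P ∈ A ∪ B, P ^ 2 ∣ f0 - (if P ∈ A then 0 else -J) := by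
      obtain ⟨r, hr⟩ := Ideal.exists_forall_sub_mem_ideal (R := F[X]) (ι := ↥(A ∪ B))
        (I := fun P => Ideal.span {(P : F[X]) ^ 2}) (by
          intro P Q hne
          simp only [Function.onFun]
          rw [Ideal.isCoprime_span_singleton_iff]
          exact (coprime_of (hAB P P.2) (hAB Q Q.2) (fun h => hne (Subtype.ext h))).pow)
        (fun P => if (P : F[X]) ∈ A then 0 else -J)
      exact ⟨r, fun P hP => Ideal.mem_span_singleton.mp (hr ⟨P, hP⟩)⟩
    obtain ⟨f0, hf0⟩ := hex
    have hiff : ∀ f : F[X], ((∀ P ∈ A, P ^ 2 ∣ f) ∧ ∀ P ∈ B, P ^ 2 ∣ f + J) ↔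
        (∏ P ∈ A ∪ B, P ^ 2) ∣ f - f0 := by
      intro f
      rw [prod_dvd hAB]
      constructor
      · rintro ⟨h1, h2⟩ P hP
        have h3 := hf0 P hP
        split_ifs at h3 with h4
        · simpa using dvd_sub (h1 P h4) h3
        · have h5 : P ∈ B := by simpa [h4] using hP
          have := dvd_sub (h2 P h5) h3
          convert this using 1
          ring
      · intro h
        constructor
        · intro P hP
          have h3 := hf0 P (Finset.mem_union_left _ hP)
          rw [if_pos hP] at h3
          simpa using dvd_add (h P (Finset.mem_union_left _ hP)) h3
        · intro P hP
          have h3 := hf0 P (Finset.mem_union_right _ hP)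
          have h6 := h P (Finset.mem_union_right _ hP)
          split_ifs at h3 with h4
          · have h7 := hJ P (Finset.mem_inter.mpr ⟨h4, hP⟩)
            have := dvd_add (dvd_add h6 h3) h7
            convert this using 1
            ring
          · have := dvd_add h6 h3
            convert this using 1
            ring
    simp only [hiff, one_mul]
    by_cases h : 2 * DD (A ∪ B) ≤ n
    · have := card_modEq n (∏ P ∈ A ∪ B, P ^ 2) f0 (prod_monic hAB) (by rw [prod_deg hAB]; exact h)
      rw [this, prod_deg hAB]
      push_cast
      rw [inv_pow, pow_sub₀ _ hq0 h]
      simp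
    · have h1 := card_modEq_le n (∏ P ∈ A ∪ B, P ^ 2) f0 (by rw [prod_deg hAB]; omega)
      have h1' : (((Mn F n).filter (fun f => (∏ P ∈ A ∪ B, P ^ 2) ∣ f - f0)).card : ℝ) ≤ 1 := by
        exact_mod_cast h1
      have h2 : (Fintype.card F : ℝ) ^ n * ((Fintype.card F : ℝ)⁻¹) ^ (2 * DD (A ∪ B)) ≤ 1 := by
        rw [inv_pow, ← div_eq_mul_inv, div_le_one (by positivity)]
        exact pow_le_pow_right₀ hq.le (by omega)
      have h3 : 0 ≤ (Fintype.card F : ℝ) ^ n * ((Fintype.card F : ℝ)⁻¹) ^ (2 * DD (A ∪ B)) := by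
        positivity
      have h4 : (0 : ℝ) ≤ (((Mn F n).filter (fun f => (∏ P ∈ A ∪ B, P ^ 2) ∣ f - f0)).card : ℝ) := by
        positivity
      rw [abs_le]
      constructor <;> linarith
  · have : (Mn F n).filter (fun f => (∀ P ∈ A, P ^ 2 ∣ f) ∧ ∀ P ∈ B, P ^ 2 ∣ f + J) = ∅ := by
      rw [Finset.filter_eq_empty_iff]
      rintro f - ⟨h1, h2⟩
      apply hJ
      intro P hP
      rw [Finset.mem_inter] at hP
      simpa using dvd_sub (h2 P hP.2) (h1 P hP.1)
    rw [this]
    simp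


lemma sqf_eq (n : ℕ) {S : Finset F[X]} (hS : ∀ P ∈ S, P.Monic ∧ Irreducible P)
    (hf : ∀ P : F[X], P.Monic → Irreducible P → P.natDegree ≤ n → P ∈ S)
    (f : F[X]) (hfn : f ∈ Mn F n) :
    (if Squarefree f then (1 : ℝ) else 0) =
      ∑ A ∈ S.powerset, (-1) ^ A.card * (if ∀ P ∈ A, P ^ 2 ∣ f then 1 else 0) := by
  rw [mem_Mn] at hfn
  have h1 : ∑ A ∈ S.powerset, (-1 : ℝ) ^ A.card * (if ∀ P ∈ A, P ^ 2 ∣ f then 1 else 0) =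
      ∏ P ∈ S, (1 + if P ^ 2 ∣ f then (-1 : ℝ) else 0) := by
    rw [Finset.prod_one_add]
    refine Finset.sum_congr rfl fun A _ => ?_
    rw [Finset.prod_ite_zero]
    simp
  rw [h1]
  split_ifs with h
  · symm
    apply Finset.prod_eq_one
    intro P hP
    rw [if_neg, add_zero]
    intro hd
    rw [sq] at hd
    exact (hS P hP).2.not_isUnit (h P hd)
  · symm
    rw [squarefree_iff_irreducible_sq_not_dvd_of_ne_zero hfn.1.ne_zero] at h
    push Not at h
    obtain ⟨Q, hQ, hd⟩ := h
    have hlc : Q.leadingCoeff ≠ 0 := leadingCoeff_ne_zero.mpr hQ.ne_zero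
    have hass : Associated (Q * C Q.leadingCoeff⁻¹) Q := by
      refine associated_mul_unit_left _ _ ?_
      exact isUnit_C.mpr (IsUnit.mk0 _ (inv_ne_zero hlc))
    have hd2 : (Q * C Q.leadingCoeff⁻¹) * (Q * C Q.leadingCoeff⁻¹) ∣ f :=
      (hass.mul_mul hass).dvd.trans hd
    have hir : Irreducible (Q * C Q.leadingCoeff⁻¹) := hass.irreducible_iff.mpr hQ
    refine Finset.prod_eq_zero (i := Q * C Q.leadingCoeff⁻¹) ?_ ?_
    · refine hf _ (monic_mul_leadingCoeff_inv hQ.ne_zero) hir ?_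
      rw [← hfn.2]
      exact natDegree_le_of_dvd ((dvd_mul_right _ _).trans hd2) hfn.1.ne_zero
    · rw [sq, if_pos hd2]; norm_num

lemma DD_insert {a : F[X]} {A : Finset F[X]} (h : a ∉ A) :
    DD (insert a A) = a.natDegree + DD A := by
  rw [DD, Finset.sum_insert h, DD]

lemma euler (x : ℝ) (J : F[X]) (S : Finset F[X]) :
    ∑ A ∈ S.powerset, ∑ B ∈ S.powerset, (-1) ^ A.card * (-1) ^ B.card *
      ((if ∀ P ∈ A ∩ B, P ^ 2 ∣ J then 1 else 0) * x ^ (2 * DD (A ∪ B))) =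
      ∏ P ∈ S, (1 - (if P ^ 2 ∣ J then 1 else 2) * x ^ (2 * P.natDegree)) := by
  induction S using Finset.induction_on with
  | empty => simp [DD]
  | insert a S ha ih =>
    rw [Finset.prod_insert ha, ← ih]
    simp only [Finset.sum_powerset_insert ha]
    rw [← Finset.sum_add_distrib, Finset.mul_sum]
    refine Finset.sum_congr rfl fun A hA => ?_
    rw [← Finset.sum_add_distrib, ← Finset.sum_add_distrib, ← Finset.sum_add_distrib,
      Finset.mul_sum]
    refine Finset.sum_congr rfl fun B hB => ?_
    rw [Finset.mem_powerset] at hA hB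
    have h1 : a ∉ A := fun h => ha (hA h)
    have h2 : a ∉ B := fun h => ha (hB h)
    have h3 : a ∉ A ∪ B := by simp [h1, h2]
    have e1 : insert a A ∩ B = A ∩ B := Finset.insert_inter_of_notMem h2
    have e2 : A ∩ insert a B = A ∩ B := Finset.inter_insert_of_notMem h1
    have e3 : insert a A ∩ insert a B = insert a (A ∩ B) := (Finset.insert_inter_distrib _ _ _).symm
    have e4 : insert a A ∪ B = insert a (A ∪ B) := Finset.insert_union _ _ _
    have e5 : A ∪ insert a B = insert a (A ∪ B) := Finset.union_insert _ _ _
    have e6 : insert a A ∪ insert a B = insert a (A ∪ B) := (Finset.insert_union_distrib _ _ _).symm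
    rw [e1, e2, e3, e4, e5, e6, DD_insert h3, Finset.card_insert_of_notMem h1,
      Finset.card_insert_of_notMem h2]
    simp only [Finset.forall_mem_insert]
    by_cases h4 : a ^ 2 ∣ J <;> by_cases h5 : ∀ P ∈ A ∩ B, P ^ 2 ∣ J <;>
      simp only [h4, h5, if_true, if_false, true_and, false_and, and_false] <;> ring

lemma geom_aux (x : ℝ) (hx0 : 0 ≤ x) (hx : x ≤ 1 / 2) (a K : ℕ) :
    ∑ j ∈ Finset.range K, (if a ≤ j then x ^ j else 0) ≤ 2 * x ^ a := by
  have key : ∑ j ∈ Finset.range K, (if a ≤ j then x ^ j else 0) ≤ 2 * x ^ a - 2 * x ^ (max a K) := by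
    induction K with
    | zero => simp
    | succ K ih =>
      rw [Finset.sum_range_succ]
      split_ifs with h
      · rw [max_eq_right h] at ih
        rw [max_eq_right (by omega), pow_succ]
        have := pow_nonneg hx0 K
        nlinarith
      · rw [max_eq_left (by omega)] at ih ⊢
        linarith
  have := pow_nonneg hx0 (max a K)
  linarith

lemma double_aux (x : ℝ) (hx0 : 0 ≤ x) (hx : x ≤ 1 / 2) (m K : ℕ) :
    ∑ i ∈ Finset.range K, ∑ j ∈ Finset.range K, (if m ≤ i + j then x ^ i * x ^ j else 0) ≤
      2 * (m + 2) * x ^ m := by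
  have h1 : ∀ i ∈ Finset.range K, ∑ j ∈ Finset.range K, (if m ≤ i + j then x ^ i * x ^ j else 0) ≤
      2 * (if i < m then x ^ m else 0) + 2 * (if m ≤ i then x ^ i else 0) := by
    intro i _
    have e : ∀ j ∈ Finset.range K, (if m ≤ i + j then x ^ i * x ^ j else 0) =
        x ^ i * (if m - i ≤ j then x ^ j else 0) := by
      intro j _
      by_cases h : m ≤ i + j
      · rw [if_pos h, if_pos (by omega)]
      · rw [if_neg h, if_neg (by omega), mul_zero]
    rw [Finset.sum_congr rfl e, ← Finset.mul_sum]
    have := mul_le_mul_of_nonneg_left (geom_aux x hx0 hx (m - i) K) (pow_nonneg hx0 i)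
    refine this.trans ?_
    by_cases h : i < m
    · rw [if_pos h, if_neg (by omega)]
      have : x ^ m = x ^ i * x ^ (m - i) := by rw [← pow_add]; congr 1; omega
      rw [this]
      linarith
    · rw [if_neg h, if_pos (by omega), show m - i = 0 by omega]
      simp
      linarith
  refine (Finset.sum_le_sum h1).trans ?_
  rw [Finset.sum_add_distrib, ← Finset.mul_sum, ← Finset.mul_sum]
  have h2 := geom_aux x hx0 hx m K
  have h3 : ∑ i ∈ Finset.range K, (if i < m then x ^ m else 0) ≤ m * x ^ m := by
    rw [← Finset.sum_filter, Finset.sum_const, nsmul_eq_mul]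
    refine mul_le_mul_of_nonneg_right ?_ (pow_nonneg hx0 m)
    have : (Finset.range K).filter (fun i => i < m) ⊆ Finset.range m := by
      intro i hi
      simp at hi ⊢
      exact hi.2
    have := Finset.card_le_card this
    rw [Finset.card_range] at this
    exact_mod_cast this
  linarith

lemma fiber_card {S : Finset F[X]} (hS : ∀ P ∈ S, P.Monic ∧ Irreducible P) (k : ℕ) :
    (S.powerset.filter (fun A => DD A = k)).card ≤ Fintype.card F ^ k := by
  rw [← card_Mn]
  refine Finset.card_le_card_of_injOn (fun A => ∏ P ∈ A, P) ?_ ?_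
  · intro A hA
    simp only [Finset.coe_filter, Finset.mem_powerset, Set.mem_ofPred_eq] at hA
    have hm : ∀ P ∈ A, P.Monic := fun P hP => (hS P (hA.1 hP)).1
    simp only [Finset.mem_coe, mem_Mn]
    refine ⟨monic_prod_of_monic A (fun P => P) hm, ?_⟩
    rw [natDegree_prod_of_monic A (fun P => P) hm]
    exact hA.2
  · have key : ∀ A ⊆ S, ∀ P ∈ S, P ∈ A ↔ P ∣ ∏ Q ∈ A, Q := by
      intro A hA P hP
      constructor
      · intro h; exact Finset.dvd_prod_of_mem (fun P : F[X] => P) h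
      · intro h
        rw [(hS P hP).2.prime.dvd_finsetProd_iff] at h
        obtain ⟨Q, hQ, hd⟩ := h
        have := eq_of_monic_of_associated (hS P hP).1 (hS Q (hA hQ)).1
          (((hS P hP).2.dvd_irreducible_iff_associated (hS Q (hA hQ)).2).mp hd)
        rw [this]; exact hQ
    intro A hA B hB hAB
    simp only [Finset.coe_filter, Finset.mem_powerset, Set.mem_ofPred_eq] at hA hB hAB
    ext P
    constructor
    · intro h
      rw [key B hB.1 P (hA.1 h), ← hAB, ← key A hA.1 P (hA.1 h)]
      exact h
    · intro h
      rw [key A hA.1 P (hB.1 h), hAB, ← key B hB.1 P (hB.1 h)]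
      exact h

lemma sum_powerset_le {S : Finset F[X]} (hS : ∀ P ∈ S, P.Monic ∧ Irreducible P)
    (g : ℕ → ℝ) (hg : ∀ k, 0 ≤ g k) :
    ∑ A ∈ S.powerset, g (DD A) ≤
      ∑ k ∈ Finset.range (DD S + 1), (Fintype.card F : ℝ) ^ k * g k := by
  rw [← Finset.sum_fiberwise_of_maps_to (g := DD) (t := Finset.range (DD S + 1))]
  · refine Finset.sum_le_sum fun k _ => ?_
    rw [Finset.sum_congr rfl (g := fun _ => g k), Finset.sum_const, nsmul_eq_mul]
    · refine mul_le_mul_of_nonneg_right ?_ (hg k)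
      exact_mod_cast fiber_card hS k
    · intro A hA
      rw [(Finset.mem_filter.mp hA).2]
  · intro A hA
    rw [Finset.mem_powerset] at hA
    rw [Finset.mem_range, Nat.lt_succ_iff]
    exact Finset.sum_le_sum_of_subset hA

lemma qx (k : ℕ) : (Fintype.card F : ℝ) ^ k * ((Fintype.card F : ℝ)⁻¹) ^ (2 * k) =
    ((Fintype.card F : ℝ)⁻¹) ^ k := by
  have hq := card_pos_F (F := F)
  have hq0 : (Fintype.card F : ℝ) ≠ 0 := by positivity
  rw [two_mul, pow_add, ← mul_assoc, ← mul_pow, mul_inv_cancel₀ hq0, one_pow, one_mul]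

lemma x_le : ((Fintype.card F : ℝ)⁻¹) ≤ 1 / 2 := by
  rw [one_div]
  apply inv_anti₀ (by norm_num)
  exact_mod_cast Fintype.one_lt_card (α := F)

lemma x_nonneg : 0 ≤ ((Fintype.card F : ℝ)⁻¹) := by positivity

lemma T_bound {S : Finset F[X]} (hS : ∀ P ∈ S, P.Monic ∧ Irreducible P) (m : ℕ) :
    ∑ A ∈ S.powerset, ∑ B ∈ S.powerset, (if m ≤ DD A then
      ((Fintype.card F : ℝ)⁻¹) ^ (2 * DD (A ∪ B)) else 0) ≤
      4 * (m + 2) * ((Fintype.card F : ℝ)⁻¹) ^ m := by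
  have hx0 := x_nonneg (F := F)
  have hx := x_le (F := F)
  have hqx := qx (F := F)
  have hq := card_pos_F (F := F)
  set q : ℝ := (Fintype.card F : ℝ) with hqdef
  set x : ℝ := q⁻¹ with hxdef
  set K := DD S + 1 with hK
  have step1 : ∑ A ∈ S.powerset, ∑ B ∈ S.powerset, (if m ≤ DD A then x ^ (2 * DD (A ∪ B)) else 0) ≤
      ∑ G ∈ S.powerset, ∑ H ∈ S.powerset, ∑ L ∈ S.powerset,
        (if m ≤ DD G + DD H then x ^ (2 * DD G) * x ^ (2 * DD H) * x ^ (2 * DD L) else 0) := by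
    simp only [← Finset.sum_product']
    set φ : Finset F[X] × Finset F[X] → Finset F[X] × Finset F[X] × Finset F[X] :=
      fun p => (p.1 ∩ p.2, p.1 \ p.2, p.2 \ p.1) with hφ
    have hDA : ∀ A B : Finset F[X], DD A = DD (A ∩ B) + DD (A \ B) := fun A B =>
      (Finset.sum_inter_add_sum_sdiff A B _).symm
    have hDU : ∀ A B : Finset F[X], DD (A ∪ B) = DD (A ∩ B) + DD (A \ B) + DD (B \ A) := by
      intro A B
      rw [← hDA A B, DD, DD, DD, ← Finset.sum_union Finset.disjoint_sdiff,
        Finset.union_sdiff_self_eq_union]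
    have hinj : Set.InjOn φ (S.powerset ×ˢ S.powerset : Finset _) := by
      rintro ⟨A, B⟩ - ⟨A', B'⟩ - h
      simp only [hφ, Prod.mk.injEq] at h
      obtain ⟨h1, h2, h3⟩ := h
      have hA : A = A' := by
        rw [← Finset.sdiff_union_inter A B, h1, h2, Finset.sdiff_union_inter]
      have hB : B = B' := by
        rw [← Finset.sdiff_union_inter B A, Finset.inter_comm, h1, h3, Finset.inter_comm,
          Finset.sdiff_union_inter]
      rw [hA, hB]
    have : ∑ p ∈ S.powerset ×ˢ S.powerset, (if m ≤ DD p.1 then x ^ (2 * DD (p.1 ∪ p.2)) else 0) =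
        ∑ t ∈ (S.powerset ×ˢ S.powerset).image φ, (if m ≤ DD t.1 + DD t.2.1 then
          x ^ (2 * DD t.1) * x ^ (2 * DD t.2.1) * x ^ (2 * DD t.2.2) else 0) := by
      rw [Finset.sum_image hinj]
      refine Finset.sum_congr rfl ?_
      rintro ⟨A, B⟩ -
      simp only [hφ]
      rw [← hDA A B, hDU A B]
      congr 1
      ring
    rw [this]
    refine Finset.sum_le_sum_of_subset_of_nonneg ?_ ?_
    · intro t ht
      rw [Finset.mem_image] at ht
      obtain ⟨⟨A, B⟩, hAB, rfl⟩ := ht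
      simp only [Finset.mem_product, Finset.mem_powerset] at hAB ⊢
      exact ⟨Finset.inter_subset_left.trans hAB.1, Finset.sdiff_subset.trans hAB.1,
        Finset.sdiff_subset.trans hAB.2⟩
    · intro t _ _
      split_ifs <;> positivity
  refine step1.trans ?_
  have hL : ∑ L ∈ S.powerset, x ^ (2 * DD L) ≤ 2 := by
    refine (sum_powerset_le hS (fun k => x ^ (2 * k)) (fun k => by positivity)).trans ?_
    simp only [← hqdef, hqx]
    have := geom_aux x hx0 hx 0 K
    simpa using this
  have hGH : ∑ G ∈ S.powerset, ∑ H ∈ S.powerset,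
      (if m ≤ DD G + DD H then x ^ (2 * DD G) * x ^ (2 * DD H) else 0) ≤ 2 * (m + 2) * x ^ m := by
    have a1 : ∀ G ∈ S.powerset, ∑ H ∈ S.powerset,
      (if m ≤ DD G + DD H then x ^ (2 * DD G) * x ^ (2 * DD H) else 0) ≤
        ∑ j ∈ Finset.range K, (if m ≤ DD G + j then x ^ (2 * DD G) * x ^ j else 0) := by
      intro G _
      refine (sum_powerset_le hS (fun j => if m ≤ DD G + j then x ^ (2 * DD G) * x ^ (2 * j) else 0)
        (fun k => by split_ifs <;> positivity)).trans (le_of_eq ?_)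
      refine Finset.sum_congr rfl fun j _ => ?_
      rw [← hqdef, mul_ite, mul_zero, ← hqx j]
      congr 1
      ring
    refine (Finset.sum_le_sum a1).trans ?_
    refine (sum_powerset_le hS (fun i => ∑ j ∈ Finset.range K,
      (if m ≤ i + j then x ^ (2 * i) * x ^ j else 0))
      (fun k => Finset.sum_nonneg fun j _ => by split_ifs <;> positivity)).trans ?_
    refine le_trans (le_of_eq ?_) (double_aux x hx0 hx m K)
    refine Finset.sum_congr rfl fun i _ => ?_
    rw [Finset.mul_sum]
    refine Finset.sum_congr rfl fun j _ => ?_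
    rw [← hqdef, mul_ite, mul_zero, ← hqx i]
    congr 1
    ring
  have e : ∑ G ∈ S.powerset, ∑ H ∈ S.powerset, ∑ L ∈ S.powerset,
        (if m ≤ DD G + DD H then x ^ (2 * DD G) * x ^ (2 * DD H) * x ^ (2 * DD L) else 0) =
      (∑ G ∈ S.powerset, ∑ H ∈ S.powerset,
      (if m ≤ DD G + DD H then x ^ (2 * DD G) * x ^ (2 * DD H) else 0)) *
        ∑ L ∈ S.powerset, x ^ (2 * DD L) := by
    rw [Finset.sum_mul]
    refine Finset.sum_congr rfl fun G _ => ?_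
    rw [Finset.sum_mul]
    refine Finset.sum_congr rfl fun H _ => ?_
    rw [Finset.mul_sum]
    refine Finset.sum_congr rfl fun L _ => ?_
    rw [ite_mul, zero_mul]
  rw [e]
  calc _ ≤ (2 * (m + 2) * x ^ m) * 2 := by
        refine mul_le_mul hGH hL (Finset.sum_nonneg fun L _ => by positivity) (by positivity)
    _ = _ := by ring

lemma small_card {S : Finset F[X]} (hS : ∀ P ∈ S, P.Monic ∧ Irreducible P) (Y : ℕ) :
    ((S.powerset.filter (fun A => ¬ Y + 1 ≤ DD A)).card : ℝ) ≤ 2 * (Fintype.card F : ℝ) ^ Y := by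
  have hq2 : (2 : ℝ) ≤ (Fintype.card F : ℝ) := by exact_mod_cast Fintype.one_lt_card (α := F)
  have h1 : ((S.powerset.filter (fun A => ¬ Y + 1 ≤ DD A)).card : ℝ) ≤
      ∑ k ∈ Finset.range (Y + 1), (Fintype.card F : ℝ) ^ k := by
    have : (S.powerset.filter (fun A => ¬ Y + 1 ≤ DD A)).card =
        ∑ k ∈ Finset.range (Y + 1), ((S.powerset.filter (fun A => ¬ Y + 1 ≤ DD A)).filter
          (fun A => DD A = k)).card := by
      apply Finset.card_eq_sum_card_fiberwise
      intro A hA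
      simp only [Finset.coe_filter, Set.mem_ofPred_eq] at hA
      simp only [Finset.coe_range, Set.mem_Iio]
      omega
    rw [this]
    push_cast
    refine Finset.sum_le_sum fun k _ => ?_
    have h2 := fiber_card hS k
    have h3 : (((S.powerset.filter (fun A => ¬ Y + 1 ≤ DD A)).filter
          (fun A => DD A = k)).card) ≤ (S.powerset.filter (fun A => DD A = k)).card := by
      apply Finset.card_le_card
      apply Finset.filter_subset_filter
      exact Finset.filter_subset _ _
    exact_mod_cast h3.trans h2
  refine h1.trans ?_
  clear h1
  induction Y with
  | zero => simp
  | succ Y ih =>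
    rw [Finset.sum_range_succ]
    have : (Fintype.card F : ℝ) ^ (Y + 1) = (Fintype.card F : ℝ) ^ Y * (Fintype.card F : ℝ) := pow_succ _ _
    have hp : 0 ≤ (Fintype.card F : ℝ) ^ Y := by positivity
    nlinarith

lemma add_mem_Mn {n : ℕ} {J f : F[X]} (hJ : J.natDegree < n) (hf : f ∈ Mn F n) :
    f + J ∈ Mn F n := by
  rw [mem_Mn] at hf ⊢
  have hlt : J.natDegree < f.natDegree := by rw [hf.2]; exact hJ
  refine ⟨hf.1.add_of_left (degree_lt_degree hlt), ?_⟩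
  rw [natDegree_add_eq_left_of_natDegree_lt hlt, hf.2]

lemma shift_sum {n : ℕ} {J : F[X]} (hJ : J.natDegree < n) (g : F[X] → ℝ) :
    ∑ f ∈ Mn F n, g (f + J) = ∑ f ∈ Mn F n, g f := by
  refine Finset.sum_nbij' (fun f => f + J) (fun f => f - J) ?_ ?_ ?_ ?_ ?_
  · intro f hf; exact add_mem_Mn hJ hf
  · intro f hf
    have := add_mem_Mn (J := -J) (by rwa [natDegree_neg]) hf
    simpa [sub_eq_add_neg] using this
  · intro f _; simp
  · intro f _; simp
  · intro f _; rfl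

/-- indicator that all `P ^ 2` with `P ∈ A` divide `f` -/
noncomputable def chi (A : Finset F[X]) (f : F[X]) : ℝ := if ∀ P ∈ A, P ^ 2 ∣ f then 1 else 0

lemma chi_mul (A B : Finset F[X]) (f g : F[X]) :
    chi A f * chi B g = if (∀ P ∈ A, P ^ 2 ∣ f) ∧ (∀ P ∈ B, P ^ 2 ∣ g) then 1 else 0 := by
  unfold chi
  by_cases h1 : ∀ P ∈ A, P ^ 2 ∣ f
  · by_cases h2 : ∀ P ∈ B, P ^ 2 ∣ g
    · rw [if_pos h1, if_pos h2, if_pos ⟨h1, h2⟩, one_mul]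
    · rw [if_neg h2, mul_zero, if_neg (fun h => h2 h.2)]
  · rw [if_neg h1, zero_mul, if_neg (fun h => h1 h.1)]

lemma chi_union (A B : Finset F[X]) (f : F[X]) :
    chi A f * chi B f = chi (A ∪ B) f := by
  rw [chi_mul]
  unfold chi
  simp only [Finset.mem_union, or_imp, forall_and]

lemma sum_E_sq {S : Finset F[X]} (hS : ∀ P ∈ S, P.Monic ∧ Irreducible P) (n m : ℕ) :
    ∑ f ∈ Mn F n, (∑ A ∈ S.powerset.filter (fun A => m ≤ DD A), chi A f) ^ 2 ≤
      (Fintype.card F : ℝ) ^ n * (4 * (m + 2) * ((Fintype.card F : ℝ)⁻¹) ^ m) := by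
  simp only [sq, Finset.sum_mul_sum, chi_union]
  rw [Finset.sum_comm]
  have h1 : ∀ A ∈ S.powerset.filter (fun A => m ≤ DD A),
      ∑ f ∈ Mn F n, ∑ B ∈ S.powerset.filter (fun A => m ≤ DD A), chi (A ∪ B) f ≤
      (Fintype.card F : ℝ) ^ n * ∑ B ∈ S.powerset, ((Fintype.card F : ℝ)⁻¹) ^ (2 * DD (A ∪ B)) := by
    intro A hA
    rw [Finset.sum_comm, Finset.mul_sum]
    have h2 : ∀ B ∈ S.powerset.filter (fun A => m ≤ DD A), ∑ f ∈ Mn F n, chi (A ∪ B) f ≤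
        (Fintype.card F : ℝ) ^ n * ((Fintype.card F : ℝ)⁻¹) ^ (2 * DD (A ∪ B)) := by
      intro B hB
      simp only [Finset.mem_filter, Finset.mem_powerset] at hA hB
      have hAB : ∀ P ∈ A ∪ B, P.Monic ∧ Irreducible P := fun P hP =>
        hS P (Finset.union_subset hA.1 hB.1 hP)
      refine le_trans (le_of_eq ?_) (count_single n hAB)
      simp [chi]
    refine (Finset.sum_le_sum h2).trans ?_
    refine Finset.sum_le_sum_of_subset_of_nonneg (Finset.filter_subset _ _) ?_
    intro B _ _
    positivity
  refine (Finset.sum_le_sum h1).trans ?_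
  rw [← Finset.mul_sum]
  refine mul_le_mul_of_nonneg_left ?_ (by positivity)
  refine le_trans (le_of_eq ?_) (T_bound hS m)
  rw [Finset.sum_filter]
  refine Finset.sum_congr rfl fun A _ => ?_
  split_ifs <;> simp

lemma E_le_sq (T : Finset (Finset F[X])) (f : F[X]) :
    ∑ A ∈ T, chi A f ≤ (∑ A ∈ T, chi A f) ^ 2 := by
  have : ∑ A ∈ T, chi A f = ((T.filter (fun A => ∀ P ∈ A, P ^ 2 ∣ f)).card : ℝ) := by
    simp [chi]
  rw [this]
  exact_mod_cast Nat.le_self_pow (by norm_num) _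

lemma chi_nonneg (A : Finset F[X]) (f : F[X]) : 0 ≤ chi A f := by
  unfold chi; split_ifs <;> norm_num

lemma main_finite {S : Finset F[X]} (hS : ∀ P ∈ S, P.Monic ∧ Irreducible P) (n Y : ℕ)
    (hf : ∀ P : F[X], P.Monic → Irreducible P → P.natDegree ≤ n → P ∈ S)
    (J : F[X]) (hJ : J.natDegree < n) :
    |∑ f ∈ Mn F n, (if Squarefree f then (1 : ℝ) else 0) * (if Squarefree (f + J) then (1 : ℝ) else 0)
      - (∏ P ∈ S, (1 - (if P ^ 2 ∣ J then 1 else 2) * ((Fintype.card F : ℝ)⁻¹) ^ (2 * P.natDegree))) *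
        (Fintype.card F : ℝ) ^ n| ≤
      5 * ((Fintype.card F : ℝ) ^ n * (4 * ((Y + 1 : ℕ) + 2) * ((Fintype.card F : ℝ)⁻¹) ^ (Y + 1)))
        + (2 * (Fintype.card F : ℝ) ^ Y) ^ 2 := by
  set q : ℝ := (Fintype.card F : ℝ) with hq
  set x : ℝ := q⁻¹ with hx
  have hx0 : 0 ≤ x := x_nonneg
  have hq0 : 0 ≤ q := by positivity
  set m := Y + 1 with hm
  set big := S.powerset.filter (fun A => m ≤ DD A) with hbig
  set small := S.powerset.filter (fun A => ¬ m ≤ DD A) with hsmall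
  set lam : F[X] → ℝ := fun f => ∑ A ∈ small, (-1) ^ A.card * chi A f with hlam
  set E : F[X] → ℝ := fun f => ∑ A ∈ big, chi A f with hE
  set s : F[X] → ℝ := fun f => if Squarefree f then (1 : ℝ) else 0 with hs
  set W : ℝ := 4 * ((m : ℕ) + 2) * x ^ m with hW
  have hErr : ∀ f ∈ Mn F n, |s f - lam f| ≤ E f := by
    intro f hfn
    have h1 : s f = ∑ A ∈ S.powerset, (-1) ^ A.card * chi A f := sqf_eq n hS hf f hfn
    have h2 : s f = ∑ A ∈ big, (-1) ^ A.card * chi A f + lam f := by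
      rw [h1]
      exact (Finset.sum_filter_add_sum_filter_not S.powerset (fun A => m ≤ DD A) _).symm
    rw [h2, add_sub_cancel_right]
    refine (Finset.abs_sum_le_sum_abs _ _).trans (le_of_eq ?_)
    refine Finset.sum_congr rfl fun A _ => ?_
    rw [abs_mul, abs_pow, abs_neg, abs_one, one_pow, one_mul, abs_of_nonneg (chi_nonneg _ _)]
  have hs01 : ∀ f, |s f| ≤ 1 := by
    intro f
    simp only [hs]
    split_ifs <;> simp
  -- step 1
  have step1 : |∑ f ∈ Mn F n, s f * s (f + J) - ∑ f ∈ Mn F n, lam f * lam (f + J)| ≤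
      3 * (q ^ n * W) := by
    rw [← Finset.sum_sub_distrib]
    refine (Finset.abs_sum_le_sum_abs _ _).trans ?_
    have h1 : ∀ f ∈ Mn F n, |s f * s (f + J) - lam f * lam (f + J)| ≤
        3 / 2 * (E f) ^ 2 + 3 / 2 * (E (f + J)) ^ 2 := by
      intro f hfn
      have a1 := hErr f hfn
      have a2 := hErr (f + J) (add_mem_Mn hJ hfn)
      have b1 : E f ≤ (E f) ^ 2 := E_le_sq big f
      have b2 : E (f + J) ≤ (E (f + J)) ^ 2 := E_le_sq big (f + J)
      have c1 := hs01 f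
      have c2 := hs01 (f + J)
      have e : s f * s (f + J) - lam f * lam (f + J) =
          s f * (s (f + J) - lam (f + J)) + s (f + J) * (s f - lam f)
            - (s f - lam f) * (s (f + J) - lam (f + J)) := by ring
      have d1 : |s f * (s (f + J) - lam (f + J))| ≤ 1 * E (f + J) := by
        rw [abs_mul]; exact mul_le_mul c1 a2 (abs_nonneg _) zero_le_one
      have d2 : |s (f + J) * (s f - lam f)| ≤ 1 * E f := by
        rw [abs_mul]; exact mul_le_mul c2 a1 (abs_nonneg _) zero_le_one
      have d3 : |(s f - lam f) * (s (f + J) - lam (f + J))| ≤ E f * E (f + J) := by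
        rw [abs_mul]; exact mul_le_mul a1 a2 (abs_nonneg _) ((abs_nonneg _).trans a1)
      rw [e]
      have t1 := abs_sub (s f * (s (f + J) - lam (f + J)) + s (f + J) * (s f - lam f))
        ((s f - lam f) * (s (f + J) - lam (f + J)))
      have t2 := abs_add_le (s f * (s (f + J) - lam (f + J))) (s (f + J) * (s f - lam f))
      have t3 := sq_nonneg (E f - E (f + J))
      nlinarith
    refine (Finset.sum_le_sum h1).trans ?_
    rw [Finset.sum_add_distrib, ← Finset.mul_sum, ← Finset.mul_sum,
      shift_sum hJ (fun f => (E f) ^ 2)]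
    have := sum_E_sq hS n m
    simp only [← hq, ← hx, ← hbig] at this
    have h2 : ∑ f ∈ Mn F n, (E f) ^ 2 ≤ q ^ n * W := this
    linarith
  -- step 2
  set wt : Finset F[X] → Finset F[X] → ℝ := fun A B => (-1) ^ A.card * (-1) ^ B.card with hwt
  set M : Finset F[X] → Finset F[X] → ℝ := fun A B =>
    (if ∀ P ∈ A ∩ B, P ^ 2 ∣ J then 1 else 0) * (q ^ n * x ^ (2 * DD (A ∪ B))) with hM
  have hwt1 : ∀ A B, |wt A B| = 1 := by
    intro A B; simp [hwt, abs_mul]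
  have hMle : ∀ A B, |M A B| ≤ q ^ n * x ^ (2 * DD (A ∪ B)) := by
    intro A B
    have : 0 ≤ q ^ n * x ^ (2 * DD (A ∪ B)) := by positivity
    simp only [hM]
    split_ifs
    · rw [one_mul, abs_of_nonneg this]
    · simpa using this
  have step2 : |∑ f ∈ Mn F n, lam f * lam (f + J) - ∑ A ∈ small, ∑ B ∈ small, wt A B * M A B| ≤
      (2 * q ^ Y) ^ 2 := by
    have e : ∑ f ∈ Mn F n, lam f * lam (f + J) = ∑ A ∈ small, ∑ B ∈ small, wt A B *
        (((Mn F n).filter (fun f => (∀ P ∈ A, P ^ 2 ∣ f) ∧ ∀ P ∈ B, P ^ 2 ∣ f + J)).card : ℝ) := by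
      simp only [hlam, Finset.sum_mul_sum]
      rw [Finset.sum_comm]
      refine Finset.sum_congr rfl fun A _ => ?_
      rw [Finset.sum_comm]
      refine Finset.sum_congr rfl fun B _ => ?_
      rw [Finset.card_filter, Nat.cast_sum, Finset.mul_sum]
      refine Finset.sum_congr rfl fun f _ => ?_
      rw [mul_mul_mul_comm, chi_mul]
      push_cast
      rfl
    rw [e, ← Finset.sum_sub_distrib]
    simp only [← Finset.sum_sub_distrib, ← mul_sub]
    have hc : (small.card : ℝ) ≤ 2 * q ^ Y := small_card hS Y
    calc _ ≤ ∑ A ∈ small, ∑ B ∈ small, (1 : ℝ) := by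
          refine (Finset.abs_sum_le_sum_abs _ _).trans (Finset.sum_le_sum fun A hA => ?_)
          refine (Finset.abs_sum_le_sum_abs _ _).trans (Finset.sum_le_sum fun B hB => ?_)
          rw [abs_mul, hwt1, one_mul]
          simp only [hsmall, Finset.mem_filter, Finset.mem_powerset] at hA hB
          exact count_pair n J (fun P hP => hS P (hA.1 hP)) (fun P hP => hS P (hB.1 hP))
      _ = (small.card : ℝ) ^ 2 := by simp [sq]
      _ ≤ _ := by gcongr
  -- step 3
  have hT := T_bound hS m
  have step3 : |∑ A ∈ small, ∑ B ∈ small, wt A B * M A B -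
      ∑ A ∈ S.powerset, ∑ B ∈ S.powerset, wt A B * M A B| ≤ 2 * (q ^ n * W) := by
    have e : ∑ A ∈ small, ∑ B ∈ small, wt A B * M A B =
        ∑ A ∈ S.powerset, ∑ B ∈ S.powerset,
          (if m ≤ DD A ∨ m ≤ DD B then 0 else wt A B * M A B) := by
      simp only [hsmall, Finset.sum_filter]
      refine Finset.sum_congr rfl fun A _ => ?_
      by_cases h : m ≤ DD A
      · simp [h]
      · rw [if_pos h]
        refine Finset.sum_congr rfl fun B _ => ?_
        by_cases h' : m ≤ DD B <;> simp [h, h']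
    rw [e, ← Finset.sum_sub_distrib]
    simp only [← Finset.sum_sub_distrib]
    have h1 : ∀ A B, |(if m ≤ DD A ∨ m ≤ DD B then 0 else wt A B * M A B) - wt A B * M A B| ≤
        q ^ n * (if m ≤ DD A then x ^ (2 * DD (A ∪ B)) else 0) +
        q ^ n * (if m ≤ DD B then x ^ (2 * DD (B ∪ A)) else 0) := by
      intro A B
      have h2 := hMle A B
      have h3 : 0 ≤ q ^ n * x ^ (2 * DD (A ∪ B)) := by positivity
      have h4 : |wt A B * M A B| = |M A B| := by rw [abs_mul, hwt1, one_mul]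
      rw [Finset.union_comm B A]
      by_cases c1 : m ≤ DD A <;> by_cases c2 : m ≤ DD B <;>
        simp only [c1, c2, or_true, or_false, if_true, if_false, zero_sub, abs_neg, h4,
          sub_self, abs_zero, mul_zero, add_zero, zero_add, or_self] <;> linarith
    calc _ ≤ ∑ A ∈ S.powerset, ∑ B ∈ S.powerset,
        (q ^ n * (if m ≤ DD A then x ^ (2 * DD (A ∪ B)) else 0) +
        q ^ n * (if m ≤ DD B then x ^ (2 * DD (B ∪ A)) else 0)) := by
          refine (Finset.abs_sum_le_sum_abs _ _).trans (Finset.sum_le_sum fun A hA => ?_)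
          refine (Finset.abs_sum_le_sum_abs _ _).trans (Finset.sum_le_sum fun B hB => ?_)
          exact h1 A B
      _ = 2 * (q ^ n * ∑ A ∈ S.powerset, ∑ B ∈ S.powerset,
            (if m ≤ DD A then x ^ (2 * DD (A ∪ B)) else 0)) := by
          simp only [Finset.sum_add_distrib, ← Finset.mul_sum]
          rw [Finset.sum_comm (f := fun A B => if m ≤ DD B then x ^ (2 * DD (B ∪ A)) else 0)]
          ring
      _ ≤ _ := by gcongr
  have step4 : ∑ A ∈ S.powerset, ∑ B ∈ S.powerset, wt A B * M A B =
      (∏ P ∈ S, (1 - (if P ^ 2 ∣ J then 1 else 2) * x ^ (2 * P.natDegree))) * q ^ n := by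
    rw [← euler x J S, Finset.sum_mul]
    refine Finset.sum_congr rfl fun A _ => ?_
    rw [Finset.sum_mul]
    refine Finset.sum_congr rfl fun B _ => ?_
    simp only [hwt, hM]
    ring
  rw [← step4]
  rw [abs_le] at step1 step2 step3 ⊢
  constructor <;> linarith [step1.1, step1.2, step2.1, step2.2, step3.1, step3.2]


lemma sum_prime_le {S : Finset F[X]} (hS : ∀ P ∈ S, P.Monic ∧ Irreducible P) :
    ∑ P ∈ S, ((Fintype.card F : ℝ)⁻¹) ^ (2 * P.natDegree) ≤ 2 := by
  have hx0 := x_nonneg (F := F)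
  have hx := x_le (F := F)
  have h1 : ∑ P ∈ S, ((Fintype.card F : ℝ)⁻¹) ^ (2 * P.natDegree) =
      ∑ A ∈ S.image (fun P => ({P} : Finset F[X])), ((Fintype.card F : ℝ)⁻¹) ^ (2 * DD A) := by
    rw [Finset.sum_image]
    · simp [DD]
    · intro a _ b _ h
      exact Finset.singleton_injective h
  rw [h1]
  refine (Finset.sum_le_sum_of_subset_of_nonneg (t := S.powerset) ?_ ?_).trans ?_
  · intro A hA
    rw [Finset.mem_image] at hA
    obtain ⟨P, hP, rfl⟩ := hA
    simpa using hP
  · intro A _ _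
    positivity
  · refine (sum_powerset_le hS (fun k => ((Fintype.card F : ℝ)⁻¹) ^ (2 * k))
      (fun k => by positivity)).trans ?_
    simp only [qx]
    have := geom_aux _ hx0 hx 0 (DD S + 1)
    simpa using this

lemma two_div_eq (d : ℕ) : 2 / ((Fintype.card F : ℝ) ^ d) ^ 2 =
    2 * ((Fintype.card F : ℝ)⁻¹) ^ (2 * d) := by
  rw [← pow_mul, inv_pow, mul_comm d 2]
  rfl

lemma sing_multipliable :
    Multipliable (fun P : {P : F[X] // P.Monic ∧ Irreducible P} =>
      (1 - 2 / ((Fintype.card F : ℝ) ^ (P : F[X]).natDegree) ^ 2)) := by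
  simp only [sub_eq_add_neg]
  apply Real.multipliable_one_add_of_summable
  apply Summable.neg
  simp only [two_div_eq]
  apply Summable.mul_left
  refine summable_of_sum_le (c := 2) (fun P => by positivity) ?_
  intro u
  have := sum_prime_le (S := u.map (Function.Embedding.subtype _)) (by
    intro P hP
    rw [Finset.mem_map] at hP
    obtain ⟨Q, _, rfl⟩ := hP
    exact Q.2)
  rw [Finset.sum_map] at this
  exact this

lemma factor_eq {P : F[X]} (hP : Irreducible P) (J : F[X]) :
    1 - (if P ^ 2 ∣ J then 1 else 2) * ((Fintype.card F : ℝ)⁻¹) ^ (2 * P.natDegree) =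
    (1 - 2 / ((Fintype.card F : ℝ) ^ P.natDegree) ^ 2) *
      (if P ^ 2 ∣ J then ((((Fintype.card F : ℝ) ^ P.natDegree) ^ 2 - 1) /
        (((Fintype.card F : ℝ) ^ P.natDegree) ^ 2 - 2)) else 1) := by
  have hq2 : (2 : ℝ) ≤ (Fintype.card F : ℝ) := by exact_mod_cast Fintype.one_lt_card (α := F)
  have hd : P.natDegree ≠ 0 := hP.natDegree_pos.ne'
  have h1 : (2 : ℝ) ≤ (Fintype.card F : ℝ) ^ P.natDegree :=
    hq2.trans (le_self_pow₀ (by linarith) hd)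
  split_ifs
  · rw [inv_pow, mul_comm 2, pow_mul]
    set z := (Fintype.card F : ℝ) ^ P.natDegree
    have h2 : z ^ 2 - 2 ≠ 0 := by nlinarith
    have h3 : z ≠ 0 := by linarith
    field_simp
  · rw [two_div_eq, mul_one]

lemma finprod_eq {S : Finset F[X]} (hS : ∀ P ∈ S, P.Monic ∧ Irreducible P) (n : ℕ)
    (hf : ∀ P : F[X], P.Monic → Irreducible P → P.natDegree ≤ n → P ∈ S)
    (J : F[X]) (hJ0 : J ≠ 0) (hJ : J.natDegree < n) (r : F[X] → ℝ) :
    ∏ᶠ P ∈ {P : F[X] | P.Monic ∧ Irreducible P ∧ P ^ 2 ∣ J}, r P =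
      ∏ P ∈ S, if P ^ 2 ∣ J then r P else 1 := by
  rw [← Finset.prod_filter, ← finprod_mem_coe_finset]
  have : {P : F[X] | P.Monic ∧ Irreducible P ∧ P ^ 2 ∣ J} =
      (↑(S.filter (fun P => P ^ 2 ∣ J)) : Set F[X]) := by
    ext P
    simp only [Finset.coe_filter, Set.mem_ofPred_eq]
    constructor
    · rintro ⟨h1, h2, h3⟩
      refine ⟨hf P h1 h2 ?_, h3⟩
      have := natDegree_le_of_dvd ((dvd_pow_self P two_ne_zero).trans h3) hJ0
      omega
    · rintro ⟨h1, h2⟩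
      exact ⟨(hS P h1).1, (hS P h1).2, h2⟩
  rw [this]

lemma main_lim (n Y : ℕ) (J : F[X]) (hJ0 : J ≠ 0) (hJ : J.natDegree < n) :
    |∑ f ∈ Mn F n, (if Squarefree f then (1 : ℝ) else 0) * (if Squarefree (f + J) then (1 : ℝ) else 0)
      - singSeries J * (Fintype.card F : ℝ) ^ n| ≤
      5 * ((Fintype.card F : ℝ) ^ n * (4 * ((Y + 1 : ℕ) + 2) * ((Fintype.card F : ℝ)⁻¹) ^ (Y + 1)))
        + (2 * (Fintype.card F : ℝ) ^ Y) ^ 2 := by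
  have hp := (sing_multipliable (F := F)).hasProd
  set Rr : ℝ := ∏ᶠ P ∈ {P : F[X] | P.Monic ∧ Irreducible P ∧ P ^ 2 ∣ J},
      ((((Fintype.card F : ℝ) ^ P.natDegree) ^ 2 - 1) /
        (((Fintype.card F : ℝ) ^ P.natDegree) ^ 2 - 2)) with hR
  have hp' : Filter.Tendsto (fun T : Finset {P : F[X] // P.Monic ∧ Irreducible P} =>
      ∏ P ∈ T, (1 - 2 / ((Fintype.card F : ℝ) ^ (P : F[X]).natDegree) ^ 2)) Filter.atTop
      (nhds (∏' P : {P : F[X] // P.Monic ∧ Irreducible P},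
      (1 - 2 / ((Fintype.card F : ℝ) ^ (P : F[X]).natDegree) ^ 2))) := by
    simpa [HasProd] using hp
  have ht := (((hp'.mul_const Rr).mul_const ((Fintype.card F : ℝ) ^ n)).const_sub
    (∑ f ∈ Mn F n, (if Squarefree f then (1 : ℝ) else 0) *
      (if Squarefree (f + J) then (1 : ℝ) else 0))).abs
  refine le_of_tendsto ht ?_
  set T0 : Finset {P : F[X] // P.Monic ∧ Irreducible P} :=
    ((Finset.range (n + 1)).biUnion (fun k => Mn F k)).subtype _ with hT0
  filter_upwards [Filter.eventually_ge_atTop T0] with T hT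
  set S := T.map (Function.Embedding.subtype (fun P : F[X] => P.Monic ∧ Irreducible P)) with hSdef
  have hS : ∀ P ∈ S, P.Monic ∧ Irreducible P := by
    intro P hP
    rw [hSdef, Finset.mem_map] at hP
    obtain ⟨Q, _, rfl⟩ := hP
    exact Q.2
  have hf : ∀ P : F[X], P.Monic → Irreducible P → P.natDegree ≤ n → P ∈ S := by
    intro P h1 h2 h3
    rw [hSdef, Finset.mem_map]
    refine ⟨⟨P, h1, h2⟩, hT ?_, rfl⟩
    rw [hT0, Finset.mem_subtype, Finset.mem_biUnion]
    exact ⟨P.natDegree, by simpa using Nat.lt_succ_of_le h3, mem_Mn.mpr ⟨h1, rfl⟩⟩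
  have key := main_finite hS n Y hf J hJ
  have e : ∏ P ∈ S, (1 - (if P ^ 2 ∣ J then 1 else 2) * ((Fintype.card F : ℝ)⁻¹) ^ (2 * P.natDegree))
      = (∏ P ∈ T, (1 - 2 / ((Fintype.card F : ℝ) ^ (P : F[X]).natDegree) ^ 2)) * Rr := by
    rw [Finset.prod_congr rfl fun P hP => factor_eq (hS P hP).2 J, Finset.prod_mul_distrib,
      hR, finprod_eq hS n hf J hJ0 hJ]
    congr 1
    rw [hSdef, Finset.prod_map]
    rfl
  rw [e] at key
  exact key

end aux

open scoped Classical in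
/-- there is an absolute constant `C` such that for every finite field `𝔽_q`
with `q` odd, every `n ≥ 1` and every `0 ≠ J` with `deg J < n`,
`|∑_{f ∈ M_n} μ²(f)μ²(f+J) - 𝔖(J) qⁿ| ≤ C n q^{2n/3}`. -/
theorem squarefree_pair_correlation : ∃ C : ℝ,
    ∀ (Fq : Type) [Field Fq] [Fintype Fq], Odd (Fintype.card Fq) →
    ∀ n : ℕ, 1 ≤ n → ∀ J : Fq[X], J ≠ 0 → J.natDegree < n →
      |(∑ᶠ f ∈ {f : Fq[X] | f.Monic ∧ f.natDegree = n},
            (if Squarefree f then (1 : ℝ) else 0) * (if Squarefree (f + J) then (1 : ℝ) else 0))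
          - singSeries J * (Fintype.card Fq : ℝ) ^ n|
        ≤ C * n * (Fintype.card Fq : ℝ) ^ (2 * (n : ℝ) / 3) := by
  refine ⟨84, ?_⟩
  intro F _ _ _ n hn J hJ0 hJ
  have hsum : (∑ᶠ f ∈ {f : F[X] | f.Monic ∧ f.natDegree = n},
            (if Squarefree f then (1 : ℝ) else 0) * (if Squarefree (f + J) then (1 : ℝ) else 0)) =
      ∑ f ∈ Mn F n, (if Squarefree f then (1 : ℝ) else 0) *
        (if Squarefree (f + J) then (1 : ℝ) else 0) :=
    finsum_mem_eq_finite_toFinset_sum _ (monSet_finite n)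
  rw [hsum]
  refine (main_lim n (n / 3) J hJ0 hJ).trans ?_
  have hq := card_pos_F (F := F)
  set q : ℝ := (Fintype.card F : ℝ) with hqd
  have hq0 : 0 < q := by linarith
  set R : ℝ := q ^ (2 * (n : ℝ) / 3) with hR
  set Y := n / 3 with hY
  have hY1 : 3 * Y ≤ n := by omega
  have hY2 : n ≤ 3 * (Y + 1) := by omega
  have hY1' : 3 * (Y : ℝ) ≤ n := by exact_mod_cast hY1
  have hY2' : (n : ℝ) ≤ 3 * ((Y : ℝ) + 1) := by exact_mod_cast hY2
  have hn' : (1 : ℝ) ≤ n := by exact_mod_cast hn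
  have hR0 : 0 ≤ R := by positivity
  have b1 : q ^ n * q⁻¹ ^ (Y + 1) ≤ R := by
    have : q ^ n * q⁻¹ ^ (Y + 1) = q ^ ((n : ℝ) - ((Y + 1 : ℕ) : ℝ)) := by
      rw [Real.rpow_sub hq0, Real.rpow_natCast, Real.rpow_natCast, inv_pow, div_eq_mul_inv]
    rw [this]
    apply Real.rpow_le_rpow_of_exponent_le hq.le
    push_cast
    linarith
  have b2 : (q ^ Y) ^ 2 ≤ R := by
    have : (q ^ Y) ^ 2 = q ^ (((Y * 2 : ℕ) : ℝ)) := by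
      rw [Real.rpow_natCast, pow_mul]
    rw [this]
    apply Real.rpow_le_rpow_of_exponent_le hq.le
    push_cast
    linarith
  have e : 5 * (q ^ n * (4 * (((Y + 1 : ℕ) : ℝ) + 2) * q⁻¹ ^ (Y + 1))) + (2 * q ^ Y) ^ 2 =
      20 * ((Y : ℝ) + 3) * (q ^ n * q⁻¹ ^ (Y + 1)) + 4 * (q ^ Y) ^ 2 := by
    push_cast; ring
  rw [e]
  have hY0 : (0 : ℝ) ≤ Y := by positivity
  calc _ ≤ 20 * ((Y : ℝ) + 3) * R + 4 * R := by gcongr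
    _ = (20 * ((Y : ℝ) + 3) + 4) * R := by ring
    _ ≤ (84 * n) * R := by
      apply mul_le_mul_of_nonneg_right _ hR0
      linarith
end

section
/- There is an absolute constant C such that for every finite field 𝔽_q with q odd, every integer n ≥ 2, every positive integer z with z ≤ n/2, and every nonzero J ∈ 𝔽_q[t] with deg J < n: |S(J;n) − S_z(J;n)| ≤ C·q^n/q^z, where S(J;n) = Σ_{f∈M_n} μ²(f)·μ²(f+J), μ²_z(f) = Σ_{d monic, deg d < z, d²∣f} μ(d), and S_z(J;n) = Σ_{f∈M_n} μ²_z(f)·μ²_z(f+J). -/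
open Polynomial

open scoped Classical in
/-- The Möbius function on `𝔽_q[t]`. -/
noncomputable def polyMu {Fq : Type} [Field Fq] (f : Fq[X]) : ℤ :=
  if Squarefree f then (-1) ^ (UniqueFactorizationMonoid.factors f).card else 0

/-- The truncation `μ²_z(f) = ∑_{d monic, deg d < z, d² ∣ f} μ(d)` of
`μ²(f) = ∑_{d monic, d² ∣ f} μ(d)`. -/
noncomputable def muSqTrunc {Fq : Type} [Field Fq] (z : ℕ) (f : Fq[X]) : ℝ :=
  ∑ᶠ d ∈ {d : Fq[X] | d.Monic ∧ d.natDegree < z ∧ d ^ 2 ∣ f}, (polyMu d : ℝ)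

namespace SPT
open Finset
open scoped Classical
set_option linter.unusedSectionVars false

noncomputable def monEquiv (F : Type) [Field F] (j : ℕ) :
    {f : F[X] // f.Monic ∧ f.natDegree = j} ≃ (Fin j → F) :=
  (monicEquivDegreeLT (R := F) j).trans (degreeLTEquiv F j).toEquiv

theorem finite_monic (F : Type) [Field F] [Fintype F] (j : ℕ) :
    {f : F[X] | f.Monic ∧ f.natDegree = j}.Finite := by
  have : Finite {f : F[X] // f.Monic ∧ f.natDegree = j} := Finite.of_equiv _ (monEquiv F j).symm
  exact Set.finite_coe_iff.1 this

noncomputable def Mon (F : Type) [Field F] [Fintype F] (j : ℕ) : Finset F[X] :=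
  (finite_monic F j).toFinset

variable {F : Type} [Field F] [Fintype F]

theorem mem_Mon {j : ℕ} {f : F[X]} : f ∈ Mon F j ↔ f.Monic ∧ f.natDegree = j := by
  simp [Mon]

theorem card_Mon (j : ℕ) : (Mon F j).card = Fintype.card F ^ j := by
  have h1 : (Mon F j).card = Nat.card {f : F[X] // f.Monic ∧ f.natDegree = j} := by
    rw [Mon, ← Set.ncard_eq_toFinset_card _ (finite_monic F j)]; rfl
  rw [h1, Nat.card_congr (monEquiv F j)]
  simp

/-- number of multiples of `D` -/
theorem card_dvd {D : F[X]} (hD : D.Monic) (k : ℕ) (hk : D.natDegree ≤ k) :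
    (((Mon F k).filter (D ∣ ·)).card : ℝ)
      = (Fintype.card F : ℝ) ^ k / (Fintype.card F : ℝ) ^ D.natDegree := by
  have hq : (Fintype.card F : ℝ) ≠ 0 := by simp
  have : ((Mon F k).filter (D ∣ ·)).card = (Mon F (k - D.natDegree)).card := by
    symm
    apply Finset.card_bij (fun t _ => D * t)
    · intro t ht
      rw [mem_Mon] at ht
      rw [mem_filter, mem_Mon]
      refine ⟨⟨hD.mul ht.1, ?_⟩, dvd_mul_right _ _⟩
      rw [hD.natDegree_mul ht.1, ht.2]; omega
    · intro a _ b _ h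
      exact mul_left_cancel₀ hD.ne_zero h
    · intro s hs
      rw [mem_filter, mem_Mon] at hs
      obtain ⟨⟨h1, h2⟩, t, rfl⟩ := hs
      have ht := hD.of_mul_monic_left h1
      refine ⟨t, ?_, rfl⟩
      rw [mem_Mon]
      rw [hD.natDegree_mul ht] at h2
      exact ⟨ht, by omega⟩
  rw [this, card_Mon, eq_div_iff (pow_ne_zero _ hq)]
  push_cast
  rw [← pow_add]; congr 1; omega

theorem card_dvd_zero {D : F[X]} (k : ℕ) (hk : k < D.natDegree) :
    (Mon F k).filter (D ∣ ·) = ∅ := by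
  ext s
  simp only [mem_filter, mem_Mon, notMem_empty, iff_false]
  rintro ⟨⟨h1, h2⟩, h3⟩
  have := natDegree_le_of_dvd h3 h1.ne_zero
  omega

theorem card_dvd_le {D : F[X]} (hD : D.Monic) (k : ℕ) :
    (((Mon F k).filter (D ∣ ·)).card : ℝ)
      ≤ (Fintype.card F : ℝ) ^ k / (Fintype.card F : ℝ) ^ D.natDegree := by
  rcases le_or_gt D.natDegree k with h | h
  · exact (card_dvd hD k h).le
  · rw [card_dvd_zero k h]; simp; positivity

noncomputable def U (F : Type) [Field F] [Fintype F] (n : ℕ) : Finset F[X] :=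
  ((range (n+1)).biUnion (Mon F)).filter Irreducible

theorem mem_U {n : ℕ} {P : F[X]} : P ∈ U F n ↔ P.Monic ∧ Irreducible P ∧ P.natDegree ≤ n := by
  simp only [U, mem_filter, mem_biUnion, mem_range, mem_Mon]
  constructor
  · rintro ⟨⟨a, h1, h2, h3⟩, h4⟩
    exact ⟨h2, h4, by omega⟩
  · rintro ⟨h1, h2, h3⟩
    exact ⟨⟨_, by omega, h1, rfl⟩, h2⟩

noncomputable def dg (S : Finset F[X]) : ℕ := ∑ P ∈ S, P.natDegree
noncomputable def pr (S : Finset F[X]) : F[X] := ∏ P ∈ S, P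
noncomputable def pf (n : ℕ) (s : F[X]) : Finset F[X] := (U F n).filter (· ∣ s)
noncomputable def sf (n : ℕ) (s : F[X]) : Finset F[X] := (U F n).filter (· ^ 2 ∣ s)
noncomputable def G (A : Finset F[X]) (w : ℕ) : ℝ :=
  ∑ S ∈ A.powerset.filter (fun S => dg S < w), (-1 : ℝ) ^ S.card

theorem pr_monic {n : ℕ} {S : Finset F[X]} (hS : S ⊆ U F n) : (pr S).Monic :=
  monic_prod_of_monic _ _ fun _ hP => (mem_U.1 (hS hP)).1

theorem pr_natDegree {n : ℕ} {S : Finset F[X]} (hS : S ⊆ U F n) : (pr S).natDegree = dg S :=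
  natDegree_prod_of_monic _ _ fun _ hP => (mem_U.1 (hS hP)).1

theorem U_coprime {n : ℕ} {P Q : F[X]} (hP : P ∈ U F n) (hQ : Q ∈ U F n) (h : P ≠ Q) :
    IsCoprime P Q := by
  rw [mem_U] at hP hQ
  rcases (or_comm.1 (dvd_or_isCoprime P Q hP.2.1)) with h1 | h1
  · exact h1
  · exact absurd (eq_of_monic_of_associated hP.1 hQ.1 (hP.2.1.associated_of_dvd hQ.2.1 h1)) h

theorem pr_dvd {n : ℕ} {S : Finset F[X]} (hS : S ⊆ U F n) (s : F[X]) :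
    pr S ∣ s ↔ S ⊆ pf n s := by
  constructor
  · intro h P hP
    rw [pf, mem_filter]
    exact ⟨hS hP, (dvd_prod_of_mem _ hP).trans h⟩
  · intro h
    apply Finset.prod_dvd_of_coprime
    · intro P hP Q hQ hne
      exact U_coprime (hS hP) (hS hQ) hne
    · intro P hP
      exact (mem_filter.1 (h hP)).2

theorem pr_sq_dvd {n : ℕ} {S : Finset F[X]} (hS : S ⊆ U F n) (s : F[X]) :
    pr S ^ 2 ∣ s ↔ S ⊆ sf n s := by
  constructor
  · intro h P hP
    rw [sf, mem_filter]
    have h1 : P ∣ pr S := dvd_prod_of_mem (fun x => x) hP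
    exact ⟨hS hP, (pow_dvd_pow_of_dvd h1 2).trans h⟩
  · intro h
    rw [pr, ← prod_pow]
    apply Finset.prod_dvd_of_coprime
    · intro P hP Q hQ hne
      exact (U_coprime (hS hP) (hS hQ) hne).pow
    · intro P hP
      exact (mem_filter.1 (h hP)).2

theorem pf_pr {n : ℕ} {S : Finset F[X]} (hS : S ⊆ U F n) : pf n (pr S) = S := by
  apply Subset.antisymm
  · intro P hP
    rw [pf, mem_filter] at hP
    have hP' := mem_U.1 hP.1
    obtain ⟨Q, hQ, h⟩ := (hP'.2.1.prime.dvd_finsetProd_iff _).1 hP.2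
    by_contra hne
    have : P ≠ Q := by rintro rfl; exact hne hQ
    exact hP'.2.1.not_isUnit ((U_coprime hP.1 (hS hQ) this).isUnit_of_dvd' dvd_rfl h)
  · exact (pr_dvd hS _).1 dvd_rfl

theorem pr_squarefree {n : ℕ} {S : Finset F[X]} (hS : S ⊆ U F n) : Squarefree (pr S) := by
  apply Finset.squarefree_prod_of_pairwise_isCoprime
  · intro P hP Q hQ hne
    exact (U_coprime (hS hP) (hS hQ) hne).isRelPrime
  · intro P hP
    exact (mem_U.1 (hS hP)).2.1.squarefree

theorem polyMu_pr {n : ℕ} {S : Finset F[X]} (hS : S ⊆ U F n) : polyMu (pr S) = (-1) ^ S.card := by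
  rw [polyMu, if_pos (pr_squarefree hS)]
  congr 1
  have h1 : Associated (UniqueFactorizationMonoid.factors (pr S)).prod (S.val).prod := by
    refine (UniqueFactorizationMonoid.factors_prod (pr_monic hS).ne_zero).trans ?_
    rw [pr, Finset.prod_val]; exact Associated.refl _
  exact Multiset.card_eq_card_of_rel (UniqueFactorizationMonoid.factors_unique
    (fun x hx => UniqueFactorizationMonoid.irreducible_of_factor x hx)
    (fun x hx => (mem_U.1 (hS hx)).2.1) h1)

theorem eq_pr {n : ℕ} {d : F[X]} (hd : d.Monic) (hn : d.natDegree ≤ n) (hs : Squarefree d) :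
    pr (pf n d) = d := by
  have hsub : pf n d ⊆ U F n := filter_subset _ _
  have h1 : pr (pf n d) ∣ d := (pr_dvd hsub d).2 subset_rfl
  obtain ⟨c, hc⟩ := h1
  have hcm : c.Monic := (pr_monic hsub).of_mul_monic_left (hc ▸ hd)
  by_cases hu : IsUnit c
  · rw [hcm.isUnit_iff.1 hu, mul_one] at hc
    exact hc.symm
  · exfalso
    obtain ⟨P, hP1, hP2, hP3⟩ := exists_monic_irreducible_factor c hu
    have hPd : P ∣ d := hP3.trans ⟨_, by rw [mul_comm]; exact hc⟩
    have hPU : P ∈ pf n d := by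
      rw [pf, mem_filter, mem_U]
      exact ⟨⟨hP1, hP2, (natDegree_le_of_dvd hPd hd.ne_zero).trans hn⟩, hPd⟩
    have : P * P ∣ d := by
      conv_rhs => rw [hc]
      exact mul_dvd_mul (dvd_prod_of_mem _ hPU) hP3
    exact hP2.not_isUnit (hs P this)

theorem muSqTrunc_eq {n z : ℕ} (hz : z ≤ n) (f : F[X]) : muSqTrunc z f = G (sf n f) z := by
  have hsub : sf n f ⊆ U F n := filter_subset _ _
  have hfin : {d : F[X] | d.Monic ∧ d.natDegree < z ∧ d ^ 2 ∣ f}.Finite := by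
    refine Set.Finite.subset ((range z).biUnion (Mon F)).finite_toSet ?_
    rintro d ⟨h1, h2, -⟩
    simp only [coe_biUnion, Set.mem_iUnion, mem_coe, mem_range, mem_Mon]
    exact ⟨_, h2, h1, rfl⟩
  rw [muSqTrunc, finsum_mem_eq_finite_toFinset_sum _ hfin, G]
  symm
  have key : ∀ S ∈ (sf n f).powerset.filter (fun S => dg S < z), S ⊆ U F n := by
    intro S hS
    rw [mem_filter, mem_powerset] at hS
    exact hS.1.trans hsub
  refine Finset.sum_of_injOn pr ?_ ?_ ?_ ?_
  · intro S hS T hT h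
    rw [← pf_pr (key S hS), ← pf_pr (key T hT), h]
  · intro S hS
    have hk := key S hS
    rw [mem_coe, mem_filter, mem_powerset] at hS
    simp only [Set.Finite.coe_toFinset, Set.mem_ofPred_eq]
    exact ⟨pr_monic hk, by rw [pr_natDegree hk]; exact hS.2, (pr_sq_dvd hk f).2 hS.1⟩
  · intro d hd hd2
    simp only [Set.Finite.mem_toFinset, Set.mem_ofPred_eq] at hd
    have : ¬ Squarefree d := by
      intro hs
      apply hd2
      have e := eq_pr (n := n) hd.1 (by omega) hs
      have hsb : pf n d ⊆ U F n := filter_subset _ _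
      refine ⟨pf n d, ?_, e⟩
      rw [mem_coe, mem_filter, mem_powerset]
      refine ⟨(pr_sq_dvd hsb f).1 (by rw [e]; exact hd.2.2), ?_⟩
      rw [← pr_natDegree hsb, e]; exact hd.2.1
    simp [polyMu, this]
  · intro S hS
    rw [polyMu_pr (key S hS)]; simp

theorem squarefree_iff {n : ℕ} {f : F[X]} (hf : f ∈ Mon F n) : Squarefree f ↔ sf n f = ∅ := by
  rw [mem_Mon] at hf
  rw [squarefree_iff_irreducible_sq_not_dvd_of_ne_zero hf.1.ne_zero, sf, filter_eq_empty_iff]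
  constructor
  · intro h P hP
    rw [sq]; exact h P (mem_U.1 hP).2.1
  · intro h x hx hxx
    obtain ⟨P, hP1, hP2, hP3⟩ := exists_monic_irreducible_factor x hx.not_isUnit
    have h2 : P ^ 2 ∣ f := by rw [sq]; exact (mul_dvd_mul hP3 hP3).trans hxx
    refine h (mem_U.2 ⟨hP1, hP2, ?_⟩) h2
    rw [← hf.2]
    exact natDegree_le_of_dvd ((dvd_pow_self P two_ne_zero).trans h2) hf.1.ne_zero

theorem dg_le_of_subset_pf {n m : ℕ} {t : F[X]} (ht : t ∈ Mon F m) {T : Finset F[X]}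
    (hT : T ⊆ pf n t) : dg T ≤ m := by
  have hU : T ⊆ U F n := hT.trans (filter_subset _ _)
  rw [mem_Mon] at ht
  rw [← pr_natDegree hU, ← ht.2]
  exact natDegree_le_of_dvd ((pr_dvd hU t).2 hT) ht.1.ne_zero

theorem count_pf {n k : ℕ} {S : Finset F[X]} (hS : S ⊆ U F n) (hk : dg S ≤ k) :
    ∑ s ∈ Mon F k, (if S ⊆ pf n s then (1 : ℝ) else 0)
      = (Fintype.card F : ℝ) ^ k / (Fintype.card F : ℝ) ^ dg S := by
  have := card_dvd (pr_monic hS) k (by rw [pr_natDegree hS]; exact hk)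
  rw [pr_natDegree hS] at this
  rw [← this, Finset.sum_boole]
  simp only [pr_dvd hS]

theorem dg_union (S T : Finset F[X]) : dg (S ∪ T) + dg (S ∩ T) = dg S + dg T :=
  Finset.sum_union_inter

theorem G_zero {A : Finset F[X]} {z : ℕ} (h : dg A < z) : G A z = if A = ∅ then 1 else 0 := by
  have : A.powerset.filter (fun S => dg S < z) = A.powerset := by
    apply filter_true_of_mem
    intro S hS
    exact lt_of_le_of_lt (sum_le_sum_of_subset (mem_powerset.1 hS)) h
  rw [G, this]
  have := Finset.sum_powerset_neg_one_pow_card (x := A)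
  exact_mod_cast this

theorem G_compl {A : Finset F[X]} {z : ℕ} (h : z ≤ dg A) :
    (if A = ∅ then (1:ℝ) else 0) - G A z = (-1) ^ A.card * G A (dg A - z + 1) := by
  have h1 : (if A = ∅ then (1:ℝ) else 0) = ∑ S ∈ A.powerset, (-1 : ℝ) ^ S.card := by
    have := Finset.sum_powerset_neg_one_pow_card (x := A)
    symm
    exact_mod_cast this
  rw [h1, ← Finset.sum_filter_add_sum_filter_not A.powerset (fun S => dg S < z), G, G,
    add_sub_cancel_left, mul_sum]
  have hd : ∀ S ⊆ A, dg (A \ S) + dg S = dg A := fun S hS => sum_sdiff hS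
  refine Finset.sum_nbij' (fun S => A \ S) (fun S => A \ S) ?_ ?_ ?_ ?_ ?_
  · intro S hS
    rw [mem_filter, mem_powerset] at hS ⊢
    have := hd S hS.1
    exact ⟨sdiff_subset, by omega⟩
  · intro S hS
    rw [mem_filter, mem_powerset] at hS ⊢
    have := hd S hS.1
    exact ⟨sdiff_subset, by omega⟩
  · intro S hS
    rw [mem_filter, mem_powerset] at hS
    exact Finset.sdiff_sdiff_eq_self hS.1
  · intro S hS
    rw [mem_filter, mem_powerset] at hS
    exact Finset.sdiff_sdiff_eq_self hS.1
  · intro S hS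
    rw [mem_filter, mem_powerset] at hS
    have h2 := card_sdiff_add_card_eq_card hS.1
    rw [← h2, pow_add, mul_right_comm, ← pow_add, ← two_mul, pow_mul]
    simp

noncomputable def tl (A : Finset F[X]) (z : ℕ) : ℝ := (if A = ∅ then (1:ℝ) else 0) - G A z

def wv (k z : ℕ) : ℕ := if 2 * (z - 1) ≤ k then z else k - z + 1

theorem wv_pos {k z : ℕ} (hz : 0 < z) : 0 < wv k z := by
  unfold wv; split_ifs <;> omega

theorem wv_le {k z : ℕ} (hk : z ≤ k) : 2 * (wv k z - 1) ≤ k := by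
  unfold wv; split_ifs <;> omega

theorem tl_sq {A : Finset F[X]} {z : ℕ} (hz : 0 < z) (h : z ≤ dg A) :
    tl A z ^ 2 = G A (wv (dg A) z) ^ 2 := by
  unfold wv
  split_ifs with h1
  · have : A ≠ ∅ := by rintro rfl; simp [dg] at h; omega
    simp [tl, this]
  · rw [tl, G_compl h, mul_pow, ← pow_mul, mul_comm _ 2, pow_mul]; simp

theorem tl_int (A : Finset F[X]) (z : ℕ) : ∃ m : ℤ, tl A z = m := by
  refine ⟨(if A = ∅ then 1 else 0) -
    ∑ S ∈ A.powerset.filter (fun S => dg S < z), (-1 : ℤ) ^ S.card, ?_⟩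
  rw [tl, G]; push_cast; rfl

theorem abs_tl_le (A : Finset F[X]) (z : ℕ) : |tl A z| ≤ tl A z ^ 2 := by
  obtain ⟨m, hm⟩ := tl_int A z
  rw [hm]
  have : |m| ≤ m ^ 2 := by
    rw [← sq_abs]
    rcases eq_or_ne m 0 with h | h
    · simp [h]
    · have := Int.one_le_abs h
      nlinarith
  exact_mod_cast this

theorem G_pf {n w : ℕ} (s : F[X]) : G (pf n s) w =
    ∑ S ∈ (U F n).powerset.filter (fun S => dg S < w),
      (-1 : ℝ) ^ S.card * (if S ⊆ pf n s then (1 : ℝ) else 0) := by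
  simp only [mul_ite, mul_one, mul_zero]
  rw [← sum_filter, G]
  apply sum_congr _ (fun _ _ => rfl)
  ext S
  simp only [mem_filter, mem_powerset]
  constructor
  · rintro ⟨h1, h2⟩
    exact ⟨⟨h1.trans (filter_subset _ _), h2⟩, h1⟩
  · rintro ⟨⟨_, h2⟩, h1⟩
    exact ⟨h1, h2⟩

/-- inner local product bound -/
theorem inner_bound (A S : Finset F[X]) :
    |∑ T ∈ A.powerset, (-1 : ℝ) ^ T.card * (Fintype.card F : ℝ) ^ dg (S ∩ T)|
      ≤ if A ⊆ S then (Fintype.card F : ℝ) ^ dg A else 0 := by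
  have hq : (1 : ℝ) ≤ Fintype.card F := by
    exact_mod_cast Fintype.card_pos
  have h1 : ∑ T ∈ A.powerset, (-1 : ℝ) ^ T.card * (Fintype.card F : ℝ) ^ dg (S ∩ T)
      = ∏ P ∈ A, (1 + (-(if P ∈ S then (Fintype.card F : ℝ) ^ P.natDegree else 1))) := by
    rw [Finset.prod_one_add]
    apply sum_congr rfl
    intro T _
    rw [prod_neg]
    congr 1
    rw [dg, ← prod_pow_eq_pow_sum, prod_ite, inter_comm, ← filter_mem_eq_inter]
    simp
  rw [h1]
  split_ifs with h
  · rw [abs_prod, dg, ← prod_pow_eq_pow_sum]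
    apply prod_le_prod (fun _ _ => abs_nonneg _)
    intro P hP
    rw [if_pos (h hP)]
    have := one_le_pow₀ hq (n := P.natDegree)
    rw [abs_le]; constructor <;> linarith
  · obtain ⟨P, hP, hPS⟩ := not_subset.1 h
    rw [prod_eq_zero hP]
    · simp
    · simp [hPS]

theorem exists_sq_part (m : ℕ) : ∀ t : F[X], t.Monic → t.natDegree = m →
    ∃ a b : F[X], a.Monic ∧ b.Monic ∧ Squarefree a ∧ t = a * b ^ 2 := by
  induction m using Nat.strong_induction_on with
  | _ m ih =>
    intro t ht hm
    by_cases hs : Squarefree t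
    · exact ⟨t, 1, ht, monic_one, hs, by simp⟩
    · rw [squarefree_iff_irreducible_sq_not_dvd_of_ne_zero ht.ne_zero] at hs
      push Not at hs
      obtain ⟨x, hx, hxx⟩ := hs
      obtain ⟨P, hP1, hP2, hP3⟩ := exists_monic_irreducible_factor x hx.not_isUnit
      obtain ⟨y, hy⟩ := (mul_dvd_mul hP3 hP3).trans hxx
      have hym : y.Monic := (hP1.mul hP1).of_mul_monic_left (hy ▸ ht)
      have hdeg : m = P.natDegree + P.natDegree + y.natDegree := by
        rw [← hm, hy, (hP1.mul hP1).natDegree_mul hym, hP1.natDegree_mul hP1]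
      have := hP2.natDegree_pos
      obtain ⟨a, b, ha, hb, hsa, e⟩ := ih y.natDegree (by omega) y hym rfl
      exact ⟨a, P * b, ha, hP1.mul hb, hsa, by rw [hy, e]; ring⟩

theorem deficiency {n m : ℕ} (hmn : m ≤ n) {t : F[X]} (ht : t ∈ Mon F m) :
    (m : ℝ) - dg (pf n t) ≤
      ∑ j ∈ range (m+1), ∑ b ∈ Mon F j, if b ^ 2 ∣ t then 2 * (j : ℝ) else 0 := by
  have ht' := mem_Mon.1 ht
  obtain ⟨a, b, ha, hb, hsa, e⟩ := exists_sq_part m t ht'.1 ht'.2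
  have hdeg : m = a.natDegree + 2 * b.natDegree := by
    rw [← ht'.2, e, ha.natDegree_mul (hb.pow 2), hb.natDegree_pow]
  have h1 : a.natDegree ≤ dg (pf n t) := by
    have hsb : pf n a ⊆ U F n := filter_subset _ _
    have ea := eq_pr (n := n) ha (by omega) hsa
    rw [← ea, pr_natDegree hsb]
    apply sum_le_sum_of_subset
    rw [← pr_dvd hsb, ea, e]
    exact dvd_mul_right _ _
  have h2 : (m : ℝ) - dg (pf n t) ≤ 2 * (b.natDegree : ℝ) := by
    have : (m : ℝ) = a.natDegree + 2 * b.natDegree := by exact_mod_cast hdeg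
    have : (a.natDegree : ℝ) ≤ dg (pf n t) := by exact_mod_cast h1
    linarith
  refine h2.trans ?_
  have hnn : ∀ (j : ℕ) (c : F[X]), (0:ℝ) ≤ if c ^ 2 ∣ t then 2 * (j : ℝ) else 0 := by
    intro j c; split_ifs <;> positivity
  have h3 := single_le_sum (f := fun j => ∑ b ∈ Mon F j, if b ^ 2 ∣ t then 2 * (j : ℝ) else 0)
    (fun j _ => sum_nonneg fun c _ => hnn j c) (mem_range.2 (by omega : b.natDegree < m + 1))
  refine le_trans ?_ h3
  have h4 := single_le_sum (f := fun c : F[X] => if c ^ 2 ∣ t then 2 * (b.natDegree : ℝ) else 0)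
    (fun c _ => hnn b.natDegree c) (mem_Mon.2 ⟨hb, rfl⟩ : b ∈ Mon F b.natDegree)
  refine le_trans ?_ h4
  rw [if_pos (by rw [e]; exact dvd_mul_left _ _)]

theorem sum_j (N : ℕ) : ∑ j ∈ range N, (j : ℝ) / 2 ^ j = 2 - (2 * N + 2) / 2 ^ N := by
  induction N with
  | zero => simp
  | succ N ih => rw [sum_range_succ, ih, pow_succ]; push_cast; field_simp; ring

theorem deficiency_sum {n m : ℕ} (hmn : m ≤ n) :
    ∑ t ∈ Mon F m, ((m : ℝ) + 1 - dg (pf n t)) ≤ 5 * (Fintype.card F : ℝ) ^ m := by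
  have hq : (2 : ℝ) ≤ Fintype.card F := by
    exact_mod_cast Fintype.one_lt_card (α := F)
  have hq0 : (0 : ℝ) < Fintype.card F := by linarith
  have h0 : ∀ t ∈ Mon F m, ((m : ℝ) + 1 - dg (pf n t)) ≤ 1 + 
      ∑ j ∈ range (m+1), ∑ b ∈ Mon F j, if b ^ 2 ∣ t then 2 * (j : ℝ) else 0 := by
    intro t ht
    have := deficiency hmn ht
    linarith
  refine (sum_le_sum h0).trans ?_
  rw [sum_add_distrib, sum_const, card_Mon, sum_comm]
  have h1 : ∀ j ∈ range (m+1), ∑ t ∈ Mon F m, ∑ b ∈ Mon F j, (if b ^ 2 ∣ t then 2 * (j : ℝ) else 0)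
      ≤ 2 * (Fintype.card F : ℝ) ^ m * ((j : ℝ) / 2 ^ j) := by
    intro j _
    rw [sum_comm]
    have h2 : ∀ b ∈ Mon F j, ∑ t ∈ Mon F m, (if b ^ 2 ∣ t then 2 * (j : ℝ) else 0)
        ≤ 2 * j * ((Fintype.card F : ℝ) ^ m / (Fintype.card F : ℝ) ^ (2 * j)) := by
      intro b hb
      rw [mem_Mon] at hb
      have := card_dvd_le (hb.1.pow 2) m
      rw [hb.1.natDegree_pow, hb.2] at this
      rw [← sum_filter, sum_const, nsmul_eq_mul, mul_comm]
      exact mul_le_mul_of_nonneg_left this (by positivity)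
    refine (sum_le_sum h2).trans ?_
    rw [sum_const, card_Mon, nsmul_eq_mul]
    push_cast
    have h3 : (Fintype.card F : ℝ) ^ j * (2 * j * ((Fintype.card F : ℝ) ^ m / (Fintype.card F : ℝ) ^ (2 * j)))
        = 2 * (Fintype.card F : ℝ) ^ m * (j / (Fintype.card F : ℝ) ^ j) := by
      rw [two_mul j, pow_add]; field_simp
    rw [h3]
    gcongr
  have h2 := sum_le_sum h1
  rw [← mul_sum, sum_j] at h2
  have h4 : (0:ℝ) ≤ (2 * ((m+1 : ℕ) : ℝ) + 2) / 2 ^ (m+1) := by positivity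
  have h5 : (0:ℝ) ≤ (Fintype.card F : ℝ) ^ m := by positivity
  rw [nsmul_eq_mul, mul_one]; push_cast at *
  nlinarith

theorem R_bound {n w : ℕ} (hw : 0 < w) (S : Finset F[X]) :
    |∑ T ∈ (U F n).powerset.filter (fun T => dg T < w),
      (-1 : ℝ) ^ T.card * ((Fintype.card F : ℝ) ^ dg (S ∩ T) / (Fintype.card F : ℝ) ^ dg T)|
    ≤ (∑ t ∈ Mon F (w-1), if pf n t ⊆ S then (Fintype.card F : ℝ) ^ dg (pf n t) else 0)
        / (Fintype.card F : ℝ) ^ (w-1) := by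
  have hq : (0 : ℝ) < Fintype.card F := by
    exact_mod_cast Fintype.card_pos
  rw [le_div_iff₀ (by positivity), ← abs_of_pos (pow_pos hq (w-1)), ← abs_mul, sum_mul]
  have h1 : ∀ T ∈ (U F n).powerset.filter (fun T => dg T < w),
      (-1 : ℝ) ^ T.card * ((Fintype.card F : ℝ) ^ dg (S ∩ T) / (Fintype.card F : ℝ) ^ dg T)
        * (Fintype.card F : ℝ) ^ (w-1)
      = ∑ t ∈ Mon F (w-1), if T ⊆ pf n t then
          (-1 : ℝ) ^ T.card * (Fintype.card F : ℝ) ^ dg (S ∩ T) else 0 := by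
    intro T hT
    rw [mem_filter, mem_powerset] at hT
    have := count_pf (k := w-1) hT.1 (by omega)
    have e : ∀ t : F[X], (if T ⊆ pf n t then
          (-1 : ℝ) ^ T.card * (Fintype.card F : ℝ) ^ dg (S ∩ T) else 0)
        = (-1 : ℝ) ^ T.card * (Fintype.card F : ℝ) ^ dg (S ∩ T) *
          (if T ⊆ pf n t then 1 else 0) := by intro t; simp
    simp only [e]
    rw [← mul_sum, this]
    ring
  rw [sum_congr rfl h1, sum_comm]
  refine (abs_sum_le_sum_abs _ _).trans (sum_le_sum ?_)
  intro t ht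
  rw [← sum_filter]
  have h2 : ((U F n).powerset.filter (fun T => dg T < w)).filter (fun T => T ⊆ pf n t)
      = (pf n t).powerset := by
    ext T
    simp only [mem_filter, mem_powerset]
    constructor
    · rintro ⟨_, h⟩; exact h
    · intro h
      have := dg_le_of_subset_pf ht h
      exact ⟨⟨h.trans (filter_subset _ _), by omega⟩, h⟩
  rw [h2]
  exact inner_bound _ _

theorem super_count {n w : ℕ} {A : Finset F[X]} (hA : A ⊆ U F n) (hw : dg A ≤ w - 1) (hw0 : 0 < w) :
    ∑ S ∈ (U F n).powerset.filter (fun T => dg T < w),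
      (if A ⊆ S then (Fintype.card F : ℝ) ^ dg A / (Fintype.card F : ℝ) ^ dg S else 0)
    ≤ ((w - 1 : ℕ) : ℝ) + 1 - dg A := by
  have hq : (0 : ℝ) < Fintype.card F := by
    exact_mod_cast Fintype.card_pos
  rw [← sum_filter]
  have hmap : ∀ S ∈ ((U F n).powerset.filter (fun T => dg T < w)).filter (fun S => A ⊆ S),
      dg S ∈ Ico (dg A) w := by
    intro S hS
    rw [mem_filter, mem_filter] at hS
    rw [mem_Ico]
    exact ⟨sum_le_sum_of_subset hS.2, hS.1.2⟩
  rw [← sum_fiberwise_of_maps_to hmap]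
  have h1 : ∀ j ∈ Ico (dg A) w,
      ∑ S ∈ (((U F n).powerset.filter (fun T => dg T < w)).filter (fun S => A ⊆ S)).filter
        (fun S => dg S = j), (Fintype.card F : ℝ) ^ dg A / (Fintype.card F : ℝ) ^ dg S ≤ 1 := by
    intro j hj
    rw [mem_Ico] at hj
    set B := (((U F n).powerset.filter (fun T => dg T < w)).filter (fun S => A ⊆ S)).filter
        (fun S => dg S = j) with hB
    have h2 : ∑ S ∈ B, (Fintype.card F : ℝ) ^ dg A / (Fintype.card F : ℝ) ^ dg S
        = ∑ S ∈ B, (Fintype.card F : ℝ) ^ dg A / (Fintype.card F : ℝ) ^ j := by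
      apply sum_congr rfl
      intro S hS
      rw [(mem_filter.1 hS).2]
    have hBU : ∀ S ∈ B, S ⊆ U F n := by
      intro S hS
      simp only [hB, mem_filter, mem_powerset] at hS
      exact hS.1.1.1
    have h3 : B.card ≤ ((Mon F j).filter (pr A ∣ ·)).card := by
      apply card_le_card_of_injOn pr
      · intro S hS
        have hSU := hBU S hS
        simp only [hB, mem_coe, mem_filter, mem_powerset] at hS
        rw [mem_coe, mem_filter, mem_Mon, pr_natDegree hSU]
        exact ⟨⟨pr_monic hSU, hS.2⟩, prod_dvd_prod_of_subset _ _ _ hS.1.2⟩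
      · intro S hS T hT h
        rw [← pf_pr (hBU S hS), ← pf_pr (hBU T hT), h]
    have h4 : (B.card : ℝ) ≤ (Fintype.card F : ℝ) ^ j / (Fintype.card F : ℝ) ^ dg A := by
      have := card_dvd_le (pr_monic hA) j
      rw [pr_natDegree hA] at this
      exact le_trans (by exact_mod_cast h3) this
    rw [h2, sum_const, nsmul_eq_mul]
    calc _ ≤ (Fintype.card F : ℝ) ^ j / (Fintype.card F : ℝ) ^ dg A *
          ((Fintype.card F : ℝ) ^ dg A / (Fintype.card F : ℝ) ^ j) := by gcongr
      _ = 1 := by field_simp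
  refine (sum_le_sum h1).trans ?_
  rw [sum_const, Nat.card_Ico, nsmul_eq_mul, mul_one]
  have : ((w - dg A : ℕ) : ℝ) + dg A = ((w-1 : ℕ) : ℝ) + 1 := by
    have : w - dg A + dg A = w - 1 + 1 := by omega
    exact_mod_cast this
  linarith

theorem second_moment {n w k : ℕ} (hw : 0 < w) (hk : 2 * (w - 1) ≤ k) (hkn : k ≤ n) :
    ∑ s ∈ Mon F k, G (pf n s) w ^ 2 ≤ 5 * (Fintype.card F : ℝ) ^ k := by
  have hq : (0 : ℝ) < Fintype.card F := by
    exact_mod_cast Fintype.card_pos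
  set q : ℝ := (Fintype.card F : ℝ) with hqdef
  set B := (U F n).powerset.filter (fun T => dg T < w) with hB
  have hBm : ∀ S ∈ B, S ⊆ U F n ∧ dg S < w := by
    intro S hS
    simpa only [hB, mem_filter, mem_powerset] using hS
  have h1 : ∑ s ∈ Mon F k, G (pf n s) w ^ 2 = ∑ S ∈ B, (-1) ^ S.card * (q ^ k / q ^ dg S) *
      ∑ T ∈ B, (-1 : ℝ) ^ T.card * (q ^ dg (S ∩ T) / q ^ dg T) := by
    simp only [sq, G_pf, ← hB, sum_mul_sum]
    rw [sum_comm]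
    apply sum_congr rfl
    intro S hS
    rw [sum_comm, mul_sum]
    apply sum_congr rfl
    intro T hT
    have hS' := hBm S hS
    have hT' := hBm T hT
    have hu := dg_union S T
    have hc := count_pf (n := n) (k := k) (union_subset hS'.1 hT'.1) (by omega)
    have e : ∀ s : F[X], (-1 : ℝ) ^ S.card * (if S ⊆ pf n s then (1:ℝ) else 0) *
        ((-1) ^ T.card * (if T ⊆ pf n s then (1:ℝ) else 0)) =
        (-1 : ℝ) ^ S.card * (-1) ^ T.card * (if S ∪ T ⊆ pf n s then (1:ℝ) else 0) := by
      intro s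
      simp only [union_subset_iff]
      by_cases h1 : S ⊆ pf n s <;> by_cases h2 : T ⊆ pf n s <;> simp [h1, h2]
    simp only [e]
    rw [← mul_sum, hc, ← hqdef]
    have : q ^ k / q ^ dg (S ∪ T) = q ^ k / q ^ dg S * (q ^ dg (S ∩ T) / q ^ dg T) := by
      have h3 : q ^ dg (S ∪ T) * q ^ dg (S ∩ T) = q ^ dg S * q ^ dg T := by
        rw [← pow_add, hu, pow_add]
      rw [div_mul_div_comm, div_eq_div_iff (by positivity) (by positivity), ← h3]
      ring
    rw [this]; ring
  rw [h1]
  calc _ ≤ ∑ S ∈ B, (q ^ k / q ^ dg S) *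
        ((∑ t ∈ Mon F (w-1), if pf n t ⊆ S then q ^ dg (pf n t) else 0) / q ^ (w-1)) := by
        apply sum_le_sum
        intro S hS
        refine (le_abs_self _).trans ?_
        rw [abs_mul, abs_mul, abs_pow, abs_neg, abs_one, one_pow, one_mul,
          abs_of_pos (by positivity : 0 < q ^ k / q ^ dg S)]
        exact mul_le_mul_of_nonneg_left (R_bound hw S) (by positivity)
    _ = (q ^ k / q ^ (w-1)) * ∑ t ∈ Mon F (w-1), ∑ S ∈ B,
        (if pf n t ⊆ S then q ^ dg (pf n t) / q ^ dg S else 0) := by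
        rw [sum_comm, mul_sum]
        apply sum_congr rfl
        intro S _
        rw [mul_div_assoc', mul_sum, sum_div, mul_sum]
        apply sum_congr rfl
        intro t _
        split_ifs
        · field_simp
        · simp
    _ ≤ (q ^ k / q ^ (w-1)) * ∑ t ∈ Mon F (w-1), (((w - 1 : ℕ) : ℝ) + 1 - dg (pf n t)) := by
        gcongr with t ht
        exact super_count (filter_subset _ _) (dg_le_of_subset_pf ht subset_rfl) hw
    _ ≤ (q ^ k / q ^ (w-1)) * (5 * q ^ (w-1)) := by
        gcongr
        exact deficiency_sum (by omega)
    _ = 5 * q ^ k := by field_simp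

theorem fixed_deg {n k w : ℕ} (hw : 0 < w) (hk : 2 * (w - 1) ≤ k) (hkn : k ≤ n) :
    ∑ A ∈ (U F n).powerset.filter (fun A => dg A = k), G A w ^ 2 ≤ 5 * (Fintype.card F : ℝ) ^ k := by
  refine le_trans ?_ (second_moment (n := n) hw hk hkn)
  set B := (U F n).powerset.filter (fun A => dg A = k) with hB
  have hBm : ∀ S ∈ B, S ⊆ U F n ∧ dg S = k := by
    intro S hS
    simpa only [hB, mem_filter, mem_powerset] using hS
  have h1 : ∑ A ∈ B, G A w ^ 2 = ∑ s ∈ B.image pr, G (pf n s) w ^ 2 := by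
    rw [sum_image]
    · apply sum_congr rfl
      intro A hA
      rw [pf_pr (hBm A hA).1]
    · intro S hS T hT h
      rw [← pf_pr (hBm S hS).1, ← pf_pr (hBm T hT).1, h]
  rw [h1]
  apply sum_le_sum_of_subset_of_nonneg
  · intro s hs
    obtain ⟨A, hA, rfl⟩ := mem_image.1 hs
    have := hBm A hA
    rw [mem_Mon, pr_natDegree this.1]
    exact ⟨pr_monic this.1, this.2⟩
  · intros; positivity

theorem tail_moment {n z : ℕ} (hz : 0 < z) :
    ∑ f ∈ Mon F n, tl (sf n f) z ^ 2
      ≤ 10 * ((Fintype.card F : ℝ) ^ n / (Fintype.card F : ℝ) ^ z) := by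
  have hq2 : (2 : ℝ) ≤ Fintype.card F := by
    exact_mod_cast Fintype.one_lt_card (α := F)
  have hq : (0 : ℝ) < Fintype.card F := by linarith
  set q : ℝ := (Fintype.card F : ℝ) with hqdef
  have hmap : ∀ f ∈ Mon F n, sf n f ∈ (U F n).powerset := fun f _ =>
    mem_powerset.2 (filter_subset _ _)
  have hsfd : ∀ f ∈ Mon F n, 2 * dg (sf n f) ≤ n := by
    intro f hf
    have hsub : sf n f ⊆ U F n := filter_subset _ _
    have h1 := (pr_sq_dvd hsub f).2 subset_rfl
    rw [mem_Mon] at hf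
    have h2 := natDegree_le_of_dvd h1 hf.1.ne_zero
    rw [(pr_monic hsub).natDegree_pow, pr_natDegree hsub, hf.2] at h2
    exact h2
  rw [← sum_fiberwise_of_maps_to hmap]
  have h1 : ∀ A ∈ (U F n).powerset,
      ∑ f ∈ (Mon F n).filter (fun f => sf n f = A), tl (sf n f) z ^ 2 ≤
        if dg A ∈ Ico z (n+1) then q ^ n / q ^ (2 * dg A) * G A (wv (dg A) z) ^ 2 else 0 := by
    intro A hA
    rw [mem_powerset] at hA
    have h2 : ∑ f ∈ (Mon F n).filter (fun f => sf n f = A), tl (sf n f) z ^ 2 =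
        ((Mon F n).filter (fun f => sf n f = A)).card * tl A z ^ 2 := by
      rw [← nsmul_eq_mul, ← sum_const]
      apply sum_congr rfl
      intro f hf
      rw [(mem_filter.1 hf).2]
    rw [h2]
    split_ifs with h
    · rw [mem_Ico] at h
      rw [tl_sq hz h.1]
      gcongr
      have h3 := card_dvd_le ((pr_monic hA).pow 2) n
      rw [(pr_monic hA).natDegree_pow, pr_natDegree hA] at h3
      refine le_trans ?_ h3
      norm_cast
      apply card_le_card
      intro f hf
      rw [mem_filter] at hf ⊢
      exact ⟨hf.1, (pr_sq_dvd hA f).2 (by rw [hf.2])⟩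
    · rw [mem_Ico] at h
      rcases lt_or_ge (dg A) z with h3 | h3
      · rw [tl, G_zero h3]; simp
      · have : (Mon F n).filter (fun f => sf n f = A) = ∅ := by
          rw [filter_eq_empty_iff]
          rintro f hf rfl
          have := hsfd f hf
          omega
        rw [this]; simp
  refine (sum_le_sum h1).trans ?_
  rw [← sum_filter, ← sum_fiberwise_of_maps_to (t := Ico z (n+1)) (g := dg)
    (fun A hA => (mem_filter.1 hA).2)]
  have h2 : ∀ k ∈ Ico z (n+1), ∑ A ∈ ((U F n).powerset.filter (fun A => dg A ∈ Ico z (n+1))).filter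
      (fun A => dg A = k), q ^ n / q ^ (2 * dg A) * G A (wv (dg A) z) ^ 2 ≤ 5 * q ^ n * (1 / q ^ k) := by
    intro k hk
    have e : ((U F n).powerset.filter (fun A => dg A ∈ Ico z (n+1))).filter (fun A => dg A = k)
        = (U F n).powerset.filter (fun A => dg A = k) := by
      rw [filter_filter]
      apply filter_congr
      intro A _
      constructor
      · exact fun h => h.2
      · exact fun h => ⟨h ▸ hk, h⟩
    rw [e]
    rw [mem_Ico] at hk
    have e2 : ∑ A ∈ (U F n).powerset.filter (fun A => dg A = k),
        q ^ n / q ^ (2 * dg A) * G A (wv (dg A) z) ^ 2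
        = q ^ n / q ^ (2 * k) * ∑ A ∈ (U F n).powerset.filter (fun A => dg A = k),
          G A (wv k z) ^ 2 := by
      rw [mul_sum]
      apply sum_congr rfl
      intro A hA
      rw [(mem_filter.1 hA).2]
    rw [e2]
    calc _ ≤ q ^ n / q ^ (2 * k) * (5 * q ^ k) := by
          gcongr
          exact fixed_deg (wv_pos hz) (wv_le hk.1) (by omega)
      _ = _ := by rw [two_mul, pow_add]; field_simp
  refine (sum_le_sum h2).trans ?_
  rw [← mul_sum, sum_Ico_eq_sum_range]
  have h3 : ∑ i ∈ range (n+1-z), 1 / q ^ (z + i) ≤ 1 / q ^ z * 2 := by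
    calc _ ≤ ∑ i ∈ range (n+1-z), 1 / q ^ z * (1/2 : ℝ) ^ i := by
          apply sum_le_sum
          intro i _
          rw [pow_add, one_div_pow, one_div_mul_one_div]
          gcongr
      _ = 1 / q ^ z * ∑ i ∈ range (n+1-z), (1/2 : ℝ) ^ i := by rw [mul_sum]
      _ ≤ _ := by
          gcongr
          exact sum_geometric_two_le _
  calc _ ≤ 5 * q ^ n * (1 / q ^ z * 2) := by gcongr
    _ = _ := by ring

theorem tail_moment_shift {n z : ℕ} (J : F[X]) (hJ : J.natDegree < n) :
    ∑ f ∈ Mon F n, tl (sf n (f + J)) z ^ 2 = ∑ f ∈ Mon F n, tl (sf n f) z ^ 2 := by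
  have hmem : ∀ K : F[X], K.natDegree < n → ∀ f ∈ Mon F n, f + K ∈ Mon F n := by
    intro K hK f hf
    rw [mem_Mon] at hf ⊢
    have hd : K.degree < f.degree := by
      apply degree_lt_degree; omega
    exact ⟨hf.1.add_of_left hd, by rw [natDegree_add_eq_left_of_degree_lt hd, hf.2]⟩
  refine sum_nbij' (fun f => f + J) (fun f => f + -J) (hmem J hJ)
    (hmem (-J) (by rwa [natDegree_neg])) ?_ ?_ ?_
  · intro f _; simp
  · intro f _; simp
  · intro f _; rfl

theorem pointwise {a b x y : ℝ} (ha : a = 0 ∨ a = 1) (hb : b = 0 ∨ b = 1)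
    (hx : |x| ≤ x ^ 2) (hy : |y| ≤ y ^ 2) :
    |a * b - (a - x) * (b - y)| ≤ 2 * (x ^ 2 + y ^ 2) := by
  have e : a * b - (a - x) * (b - y) = a * y + b * x - x * y := by ring
  rw [e]
  obtain ⟨hx1, hx2⟩ := abs_le.1 hx
  obtain ⟨hy1, hy2⟩ := abs_le.1 hy
  rw [abs_le]
  rcases ha with rfl | rfl <;> rcases hb with rfl | rfl <;> constructor <;>
    nlinarith [sq_nonneg (x - y), sq_nonneg (x + y)]

theorem mem_shift {n : ℕ} {J f : F[X]} (hJ : J.natDegree < n) (hf : f ∈ Mon F n) :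
    f + J ∈ Mon F n := by
  rw [mem_Mon] at hf ⊢
  have hd : J.degree < f.degree := by
    apply degree_lt_degree; omega
  exact ⟨hf.1.add_of_left hd, by rw [natDegree_add_eq_left_of_degree_lt hd, hf.2]⟩

end SPT

open scoped Classical in
/-- there is an absolute constant `C` such that for every finite field `𝔽_q`
with `q` odd, all `n ≥ 2`, `0 < z ≤ n/2` and `0 ≠ J` with `deg J < n`,
`|S(J;n) - S_z(J;n)| ≤ C qⁿ/q^z`, where `S(J;n) = ∑_{f ∈ M_n} μ²(f)μ²(f+J)` and
`S_z(J;n) = ∑_{f ∈ M_n} μ²_z(f)μ²_z(f+J)`. -/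
theorem squarefree_pair_truncation : ∃ C : ℝ,
    ∀ (Fq : Type) [Field Fq] [Fintype Fq], Odd (Fintype.card Fq) →
    ∀ n z : ℕ, 2 ≤ n → 0 < z → 2 * z ≤ n → ∀ J : Fq[X], J ≠ 0 → J.natDegree < n →
      |(∑ᶠ f ∈ {f : Fq[X] | f.Monic ∧ f.natDegree = n},
            (if Squarefree f then (1 : ℝ) else 0) * (if Squarefree (f + J) then (1 : ℝ) else 0))
          - (∑ᶠ f ∈ {f : Fq[X] | f.Monic ∧ f.natDegree = n},
            muSqTrunc z f * muSqTrunc z (f + J))|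
        ≤ C * (Fintype.card Fq : ℝ) ^ n / (Fintype.card Fq : ℝ) ^ z := by
  refine ⟨40, ?_⟩
  intro F _ _ _ n z _ hz hzn J _ hJ
  rw [finsum_mem_eq_finite_toFinset_sum _ (SPT.finite_monic F n),
    finsum_mem_eq_finite_toFinset_sum _ (SPT.finite_monic F n)]
  change |∑ f ∈ SPT.Mon F n, _ - ∑ f ∈ SPT.Mon F n, _| ≤ _
  rw [← Finset.sum_sub_distrib]
  refine (Finset.abs_sum_le_sum_abs _ _).trans ?_
  have key : ∀ f ∈ SPT.Mon F n,
      |(if Squarefree f then (1 : ℝ) else 0) * (if Squarefree (f + J) then (1 : ℝ) else 0)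
        - muSqTrunc z f * muSqTrunc z (f + J)|
      ≤ 2 * (SPT.tl (SPT.sf n f) z ^ 2 + SPT.tl (SPT.sf n (f + J)) z ^ 2) := by
    intro f hf
    have e : ∀ g ∈ SPT.Mon F n, muSqTrunc z g =
        (if Squarefree g then (1 : ℝ) else 0) - SPT.tl (SPT.sf n g) z := by
      intro g hg
      rw [SPT.muSqTrunc_eq (n := n) (by omega), SPT.tl]
      simp only [SPT.squarefree_iff hg]
      ring
    rw [e f hf, e _ (SPT.mem_shift hJ hf)]
    apply SPT.pointwise
    · split_ifs <;> simp
    · split_ifs <;> simp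
    · exact SPT.abs_tl_le _ _
    · exact SPT.abs_tl_le _ _
  refine (Finset.sum_le_sum key).trans ?_
  rw [← Finset.mul_sum, Finset.sum_add_distrib, SPT.tail_moment_shift J hJ]
  have := SPT.tail_moment (F := F) (n := n) hz
  rw [mul_div_assoc]
  linarith
end

section
/- There is an absolute constant C such that for every finite field 𝔽_q with q odd, every integer n ≥ 2, every positive integer z with z ≤ n/2, and every nonzero J ∈ 𝔽_q[t] with deg J < n: |S_z(J;n) − q^n·𝔖(J)| ≤ C·(q^n·z/q^z + q^{2z}), where S_z(J;n) = Σ_{f∈M_n} μ²_z(f)·μ²_z(f+J) with μ²_z(f) = Σ_{d monic, deg d < z, d²∣f} μ(d), and 𝔖(J) = ∏_P (1 − 2/|P|²) · ∏_{P : P²∣J} (|P|²−1)/(|P|²−2), the products over monic irreducible P ∈ 𝔽_q[t] with |P| = q^{deg P}. -/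
open Polynomial

abbrev MP (F : Type) [Field F] := {P : F[X] // P.Monic ∧ Irreducible P}

noncomputable def pr {F : Type} [Field F] (A : Finset (MP F)) : F[X] := ∏ P ∈ A, P.1

noncomputable def dg {F : Type} [Field F] (A : Finset (MP F)) : ℕ := ∑ P ∈ A, P.1.natDegree

theorem pr_monic {F : Type} [Field F] (A : Finset (MP F)) : (pr A).Monic :=
  monic_prod_of_monic _ _ fun P _ => P.2.1

theorem pr_natDegree {F : Type} [Field F] (A : Finset (MP F)) : (pr A).natDegree = dg A :=
  natDegree_prod_of_monic _ _ fun P _ => P.2.1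

theorem mp_dvd_pr {F : Type} [Field F] (A : Finset (MP F)) (Q : MP F) :
    Q.1 ∣ pr A ↔ Q ∈ A := by
  constructor
  · intro h
    obtain ⟨P, hP, hd⟩ := (Prime.dvd_finsetProd_iff Q.2.2.prime _).1 h
    have := Q.2.2.associated_of_dvd P.2.2 hd
    have := eq_of_monic_of_associated Q.2.1 P.2.1 this
    rwa [Subtype.ext this]
  · intro h
    exact Finset.dvd_prod_of_mem _ h

theorem pr_inj {F : Type} [Field F] : Function.Injective (pr (F := F)) := by
  intro A B h
  ext Q
  rw [← mp_dvd_pr, ← mp_dvd_pr, h]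

theorem mp_coprime {F : Type} [Field F] {P Q : MP F} (h : P ≠ Q) : IsCoprime P.1 Q.1 := by
  rw [P.2.2.coprime_iff_not_dvd]
  intro hd
  exact h (Subtype.ext (eq_of_monic_of_associated P.2.1 Q.2.1 (P.2.2.associated_of_dvd Q.2.2 hd)))

theorem pr_squarefree {F : Type} [Field F] (A : Finset (MP F)) : Squarefree (pr A) := by
  refine Finset.squarefree_prod_of_pairwise_isCoprime ?_ ?_
  · intro P _ Q _ h
    exact (mp_coprime h).isRelPrime
  · intro P _
    exact P.2.2.squarefree

theorem polyMu_pr {F : Type} [Field F] (A : Finset (MP F)) : polyMu (pr A) = (-1) ^ A.card := by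
  classical
  unfold polyMu
  rw [if_pos (pr_squarefree A)]
  congr 1
  have h := UniqueFactorizationMonoid.factors_unique (f := UniqueFactorizationMonoid.factors (pr A))
    (g := A.val.map Subtype.val) (fun x hx => UniqueFactorizationMonoid.irreducible_of_factor x hx)
    (by
      intro x hx
      obtain ⟨P, _, rfl⟩ := Multiset.mem_map.1 hx
      exact P.2.2)
    (UniqueFactorizationMonoid.factors_prod (pr_monic A).ne_zero)
  have := Multiset.card_eq_card_of_rel h
  rw [this]; simp

theorem pr_surj {F : Type} [Field F] (d : F[X]) (hd : d.Monic) (hs : Squarefree d) :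
    ∃ A, pr A = d := by
  classical
  have h0 := hd.ne_zero
  have hn := (UniqueFactorizationMonoid.squarefree_iff_nodup_normalizedFactors h0).1 hs
  refine ⟨(UniqueFactorizationMonoid.normalizedFactors d).toFinset.subtype
    (fun P => P.Monic ∧ Irreducible P), ?_⟩
  unfold pr
  rw [Finset.prod_subtype_of_mem (fun x => x)]
  · have := UniqueFactorizationMonoid.prod_normalizedFactors_eq h0
    rw [hd.normalize_eq_self] at this
    conv_rhs => rw [← this]
    rw [Finset.prod_eq_multiset_prod, Multiset.toFinset_val, hn.dedup, Multiset.map_id']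
  · intro x hx
    rw [Multiset.mem_toFinset] at hx
    have hi := UniqueFactorizationMonoid.irreducible_of_normalized_factor x hx
    refine ⟨?_, hi⟩
    rw [← UniqueFactorizationMonoid.normalize_normalized_factor x hx]
    exact monic_normalize hi.ne_zero

theorem Md_equiv_fin (F : Type) [Field F] [Fintype F] (n : ℕ) :
    Nat.card {f : F[X] // f.Monic ∧ f.natDegree = n} = Fintype.card F ^ n := by
  rw [Nat.card_congr (monicEquivDegreeLT n), Nat.card_congr (degreeLTEquiv F n).toEquiv]
  simp

theorem Md_finite (F : Type) [Field F] [Fintype F] (n : ℕ) :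
    {f : F[X] | f.Monic ∧ f.natDegree = n}.Finite := by
  apply Nat.finite_of_card_ne_zero
  change Nat.card {f : F[X] // f.Monic ∧ f.natDegree = n} ≠ 0
  rw [Md_equiv_fin]
  positivity

noncomputable def Md (F : Type) [Field F] [Fintype F] (n : ℕ) : Finset F[X] :=
  (Md_finite F n).toFinset

theorem mem_Md {F : Type} [Field F] [Fintype F] {n : ℕ} {f : F[X]} :
    f ∈ Md F n ↔ f.Monic ∧ f.natDegree = n := by simp [Md]

theorem card_Md (F : Type) [Field F] [Fintype F] (n : ℕ) :
    (Md F n).card = Fintype.card F ^ n := by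
  rw [← Md_equiv_fin F n, Md, ← Nat.card_eq_card_finite_toFinset]
  rfl

open scoped Classical in
theorem count_class {F : Type} [Field F] [Fintype F] (n : ℕ) (m r : F[X]) (hm : m.Monic) :
    |(((Md F n).filter (fun f => m ∣ f - r)).card : ℝ)
      - (Fintype.card F : ℝ) ^ n / (Fintype.card F : ℝ) ^ m.natDegree| ≤ 1 := by
  have hq : (1 : ℝ) ≤ Fintype.card F := by exact_mod_cast Fintype.card_pos
  rcases le_or_gt m.natDegree n with h | h
  · have hc : ((Md F n).filter (fun f => m ∣ f - r)).card = (Md F (n - m.natDegree)).card := by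
      symm
      have hr : (r %ₘ m).degree < m.degree := degree_modByMonic_lt _ hm
      apply Finset.card_bij (fun g _ => m * g + r %ₘ m)
      · intro g hg
        rw [mem_Md] at hg
        have hmg : (m * g).Monic := hm.mul hg.1
        have hlt : (r %ₘ m).degree < (m * g).degree := by
          refine hr.trans_le ?_
          rw [degree_mul]
          have : (0 : WithBot ℕ) ≤ g.degree := zero_le_degree_iff.2 hg.1.ne_zero
          exact le_add_of_nonneg_right this
        rw [Finset.mem_filter, mem_Md]
        refine ⟨⟨hmg.add_of_left hlt, ?_⟩, ?_⟩
        · rw [natDegree_add_eq_left_of_degree_lt hlt, hm.natDegree_mul hg.1, hg.2]; omega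
        · refine ⟨g - r /ₘ m, ?_⟩
          have := modByMonic_add_div r m
          linear_combination this
      · intro a _ b _ hab
        exact mul_left_cancel₀ hm.ne_zero (add_right_cancel hab)
      · intro f hf
        rw [Finset.mem_filter, mem_Md] at hf
        obtain ⟨⟨hf1, hf2⟩, g, hg⟩ := hf
        have hfe : m * (g + r /ₘ m) + r %ₘ m = f := by
          have := modByMonic_add_div r m
          linear_combination this - hg
        have hlt : (r %ₘ m).degree < f.degree := by
          refine hr.trans_le ?_
          rw [degree_eq_natDegree hm.ne_zero, degree_eq_natDegree hf1.ne_zero, hf2]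
          exact_mod_cast h
        have hmm : (m * (g + r /ₘ m)) = f - r %ₘ m := by rw [← hfe]; ring
        have hmon : (m * (g + r /ₘ m)).Monic := by
          rw [hmm]; exact hf1.sub_of_left hlt
        have hgm := hm.of_mul_monic_left hmon
        refine ⟨g + r /ₘ m, ?_, hfe⟩
        rw [mem_Md]
        refine ⟨hgm, ?_⟩
        have h2 : (m * (g + r /ₘ m)).natDegree = n := by
          rw [hmm, natDegree_eq_of_degree_eq (degree_sub_eq_left_of_degree_lt hlt), hf2]
        rw [hm.natDegree_mul hgm] at h2
        omega
    rw [hc, card_Md]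
    push_cast
    rw [pow_sub₀ _ (by positivity) h, div_eq_mul_inv]
    simp
  · have hc : ((Md F n).filter (fun f => m ∣ f - r)).card ≤ 1 := by
      rw [Finset.card_le_one]
      intro a ha b hb
      rw [Finset.mem_filter, mem_Md] at ha hb
      have hd : m ∣ a - b := by
        have := dvd_sub ha.2 hb.2
        simpa using this
      by_contra hne
      have h1 := natDegree_le_of_dvd hd (sub_ne_zero.2 hne)
      have h2 := natDegree_sub_le a b
      rw [ha.1.2, hb.1.2, max_self] at h2
      omega
    have h1 : (Fintype.card F : ℝ) ^ n / (Fintype.card F : ℝ) ^ m.natDegree ≤ 1 := by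
      rw [div_le_one (by positivity)]
      exact pow_le_pow_right₀ hq h.le
    have h2 : 0 ≤ (Fintype.card F : ℝ) ^ n / (Fintype.card F : ℝ) ^ m.natDegree := by positivity
    have h3 : (((Md F n).filter (fun f => m ∣ f - r)).card : ℝ) ≤ 1 := by exact_mod_cast hc
    have h4 : (0 : ℝ) ≤ (((Md F n).filter (fun f => m ∣ f - r)).card : ℝ) := by positivity
    rw [abs_le]; constructor <;> linarith

open scoped Classical in
theorem count_pair_s17 {F : Type} [Field F] [Fintype F] (n : ℕ) (g a b J : F[X]) (hg : g.Monic)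
    (ha : a.Monic) (hb : b.Monic) (hab : IsCoprime a b) :
    |(((Md F n).filter (fun f => (g * a) ^ 2 ∣ f ∧ (g * b) ^ 2 ∣ f + J)).card : ℝ)
      - (if g ^ 2 ∣ J then
        (Fintype.card F : ℝ) ^ n / ((Fintype.card F : ℝ) ^ (g * a * b).natDegree) ^ 2 else 0)| ≤ 1 := by
  split_ifs with hJ
  · obtain ⟨K, rfl⟩ := hJ
    obtain ⟨u, v, huv⟩ := (hab.pow (m := 2) (n := 2))
    have := count_class n ((g * a * b) ^ 2) (- g ^ 2 * (u * a ^ 2 * K)) (((hg.mul ha).mul hb).pow 2)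
    rw [natDegree_pow, mul_comm 2, pow_mul] at this
    convert this using 5
    apply Finset.filter_congr
    intro f _
    have hg2 : g ^ 2 ≠ 0 := pow_ne_zero _ hg.ne_zero
    constructor
    · rintro ⟨⟨x, hx⟩, ⟨y, hy⟩⟩
      have hx' : f + g ^ 2 * (u * a ^ 2 * K) = g ^ 2 * (a ^ 2 * (x + u * K)) := by
        rw [hx]; ring
      have e : a ^ 2 * (x + u * K) = b ^ 2 * (y - v * K) := by
        apply mul_left_cancel₀ hg2
        linear_combination hy - hx + g ^ 2 * K * huv
      have hd : b ^ 2 ∣ (x + u * K) :=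
        (hab.pow (m := 2) (n := 2)).symm.dvd_of_dvd_mul_left ⟨_, e⟩
      obtain ⟨w, hw⟩ := hd
      refine ⟨w, ?_⟩
      rw [hw] at hx'
      linear_combination hx'
    · rintro ⟨w, hw⟩
      refine ⟨⟨b ^ 2 * w - u * K, ?_⟩, ⟨a ^ 2 * w + v * K, ?_⟩⟩
      · linear_combination hw
      · linear_combination hw - g ^ 2 * K * huv
  · rw [Finset.filter_false_of_mem]
    · simp
    · rintro f _ ⟨h1, h2⟩
      apply hJ
      have h3 : g ^ 2 ∣ f := (Dvd.intro _ (mul_pow g a 2).symm).trans h1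
      have h4 : g ^ 2 ∣ f + J := (Dvd.intro _ (mul_pow g b 2).symm).trans h2
      exact (dvd_add_right h3).1 h4

theorem dg_mono {F : Type} [Field F] {A S : Finset (MP F)} (h : A ⊆ S) : dg A ≤ dg S :=
  Finset.sum_le_sum_of_subset h

theorem sum_fin_le {F : Type} [Field F] [Fintype F] {ι : Type} (S : Finset ι) (d : ι → F[X])
    (hd : Function.Injective d) (hm : ∀ i, (d i).Monic) (h : ℕ → ℝ)
    (h0 : ∀ k, 0 ≤ h k) (K : ℕ) (hK : ∀ i ∈ S, (d i).natDegree < K) :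
    ∑ A ∈ S, h (d A).natDegree ≤ ∑ k ∈ Finset.range K, (Fintype.card F : ℝ) ^ k * h k := by
  classical
  rw [← Finset.sum_fiberwise_of_maps_to (t := Finset.range K) (g := fun i => (d i).natDegree)
    (fun i hi => Finset.mem_range.2 (hK i hi))]
  apply Finset.sum_le_sum
  intro k _
  have : ∑ i ∈ S with (d i).natDegree = k, h (d i).natDegree
      = ((S.filter (fun i => (d i).natDegree = k)).card : ℝ) * h k := by
    rw [← nsmul_eq_mul]
    apply Finset.sum_eq_card_nsmul
    intro i hi
    rw [(Finset.mem_filter.1 hi).2]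
  rw [this]
  apply mul_le_mul_of_nonneg_right _ (h0 k)
  have h2 : (S.filter (fun i => (d i).natDegree = k)).card ≤ (Md F k).card := by
    apply Finset.card_le_card_of_injOn d
    · intro i hi
      have := (Finset.mem_filter.1 (Finset.mem_coe.1 hi)).2
      exact mem_Md.2 ⟨hm i, this⟩
    · exact hd.injOn
  rw [card_Md] at h2
  exact_mod_cast h2

theorem sum_powerset_le_s17 {F : Type} [Field F] [Fintype F] (S : Finset (MP F)) (h : ℕ → ℝ)
    (h0 : ∀ k, 0 ≤ h k) :
    ∑ A ∈ S.powerset, h (dg A) ≤ ∑ k ∈ Finset.range (dg S + 1), (Fintype.card F : ℝ) ^ k * h k := by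
  have := sum_fin_le S.powerset pr pr_inj pr_monic h h0 (dg S + 1) (by
    intro A hA
    rw [pr_natDegree]
    exact Nat.lt_succ_of_le (dg_mono (Finset.mem_powerset.1 hA)))
  simpa only [pr_natDegree] using this

theorem small_finite (F : Type) [Field F] [Fintype F] (z : ℕ) :
    {P : MP F | P.1.natDegree < z}.Finite := by
  have h1 : {f : F[X] | f.Monic ∧ f.natDegree < z}.Finite := by
    have : {f : F[X] | f.Monic ∧ f.natDegree < z} ⊆ ⋃ k ∈ Finset.range z, (Md F k : Set F[X]) := by
      intro f hf
      simp only [Set.mem_iUnion, Finset.mem_coe, mem_Md, Finset.mem_range]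
      exact ⟨_, hf.2, hf.1, rfl⟩
    refine Set.Finite.subset ?_ this
    exact Set.Finite.biUnion (Finset.finite_toSet _) (fun k _ => Finset.finite_toSet _)
  refine Set.Finite.subset (h1.preimage (f := Subtype.val) Subtype.val_injective.injOn) ?_
  intro P hP
  exact ⟨P.2.1, hP⟩

noncomputable def Sm (F : Type) [Field F] [Fintype F] (z : ℕ) : Finset (MP F) :=
  (small_finite F z).toFinset

noncomputable def Pz {F : Type} [Field F] (S : Finset (MP F)) (z : ℕ) : Finset (Finset (MP F)) :=
  S.powerset.filter (fun A => dg A < z)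

open scoped Classical in
theorem muSqTrunc_eq {F : Type} [Field F] [Fintype F] (z : ℕ) (S : Finset (MP F))
    (hS : Sm F z ⊆ S) (f : F[X]) :
    muSqTrunc z f = ∑ A ∈ Pz S z, (-1 : ℝ) ^ A.card * (if pr A ^ 2 ∣ f then 1 else 0) := by
  have h1 : ∑ A ∈ Pz S z, (-1 : ℝ) ^ A.card * (if pr A ^ 2 ∣ f then 1 else 0)
      = ∑ d ∈ ((Pz S z).filter (fun A => pr A ^ 2 ∣ f)).image pr, (polyMu d : ℝ) := by
    rw [Finset.sum_image pr_inj.injOn, Finset.sum_filter]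
    apply Finset.sum_congr rfl
    intro A _
    rw [polyMu_pr]
    split_ifs <;> simp
  rw [h1]
  unfold muSqTrunc
  apply finsum_mem_eq_sum_of_inter_support_eq
  ext d
  simp only [Set.mem_inter_iff, Set.mem_ofPred_eq, Function.mem_support, Finset.coe_image,
    Set.mem_image, Finset.mem_coe, Finset.mem_filter, Pz, Finset.mem_powerset]
  constructor
  · rintro ⟨⟨hm, hz, hd⟩, hne⟩
    refine ⟨?_, hne⟩
    have hs : Squarefree d := by
      by_contra hs
      apply hne
      simp [polyMu, hs]
    obtain ⟨A, rfl⟩ := pr_surj d hm hs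
    rw [pr_natDegree] at hz
    refine ⟨A, ⟨⟨?_, hz⟩, hd⟩, rfl⟩
    intro P hP
    apply hS
    simp only [Sm, Set.Finite.mem_toFinset, Set.mem_ofPred_eq]
    refine lt_of_le_of_lt ?_ hz
    exact Finset.single_le_sum (f := fun P : MP F => P.1.natDegree) (fun _ _ => Nat.zero_le _) hP
  · rintro ⟨⟨A, ⟨⟨_, h2⟩, h3⟩, rfl⟩, hne⟩
    exact ⟨⟨pr_monic A, by rwa [pr_natDegree], h3⟩, hne⟩

noncomputable def xx {F : Type} [Field F] [Fintype F] (P : MP F) : ℝ :=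
  1 / ((Fintype.card F : ℝ) ^ P.1.natDegree) ^ 2

open scoped Classical in
noncomputable def yy {F : Type} [Field F] (J : F[X]) (P : MP F) : ℝ :=
  if P.1 ^ 2 ∣ J then 1 else 0

theorem prod_xx {F : Type} [Field F] [Fintype F] (A : Finset (MP F)) :
    ∏ P ∈ A, xx P = 1 / ((Fintype.card F : ℝ) ^ dg A) ^ 2 := by
  unfold xx dg
  rw [Finset.prod_div_distrib, Finset.prod_pow, Finset.prod_pow_eq_pow_sum]
  simp

theorem pr_sq_dvd {F : Type} [Field F] (A : Finset (MP F)) (J : F[X]) :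
    pr A ^ 2 ∣ J ↔ ∀ P ∈ A, P.1 ^ 2 ∣ J := by
  constructor
  · intro h P hP
    exact (pow_dvd_pow_of_dvd ((mp_dvd_pr A P).2 hP) 2).trans h
  · intro h
    unfold pr
    rw [← Finset.prod_pow]
    apply Finset.prod_dvd_of_coprime
    · intro P _ Q _ hPQ
      exact (mp_coprime hPQ).pow
    · exact h

open scoped Classical in
theorem prod_yy {F : Type} [Field F] (A : Finset (MP F)) (J : F[X]) :
    ∏ P ∈ A, yy J P = if pr A ^ 2 ∣ J then 1 else 0 := by
  unfold yy
  rw [Finset.prod_ite_zero]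
  simp [pr_sq_dvd]

open scoped Classical in
noncomputable def WW {F : Type} [Field F] [Fintype F] (J : F[X]) (A B : Finset (MP F)) : ℝ :=
  (∏ P ∈ A ∪ B, xx P) * ∏ P ∈ A ∩ B, yy J P

open scoped Classical in
theorem count_AB {F : Type} [Field F] [Fintype F] (n : ℕ) (J : F[X]) (A B : Finset (MP F)) :
    |(((Md F n).filter (fun f => pr A ^ 2 ∣ f ∧ pr B ^ 2 ∣ f + J)).card : ℝ)
      - (Fintype.card F : ℝ) ^ n * WW J A B| ≤ 1 := by
  have h := count_pair_s17 n (pr (A ∩ B)) (pr (A \ B)) (pr (B \ A)) J (pr_monic _) (pr_monic _)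
    (pr_monic _) (by
      apply IsCoprime.prod_left
      intro P hP
      apply IsCoprime.prod_right
      intro Q hQ
      apply mp_coprime
      rintro rfl
      simp at hP hQ
      tauto)
  have e1 : pr (A ∩ B) * pr (A \ B) = pr A := Finset.prod_inter_mul_prod_sdiff _ _ _
  have e2 : pr (A ∩ B) * pr (B \ A) = pr B := by
    rw [Finset.inter_comm]; exact Finset.prod_inter_mul_prod_sdiff _ _ _
  have e3 : pr A * pr (B \ A) = pr (A ∪ B) := by
    rw [← Finset.union_sdiff_self_eq_union]
    exact (Finset.prod_union Finset.disjoint_sdiff).symm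
  rw [e1, e2, e3, pr_natDegree] at h
  convert h using 3
  unfold WW
  rw [prod_xx, prod_yy]
  split_ifs <;> simp [div_eq_mul_inv]

open scoped Classical in
theorem main_sum {F : Type} [Field F] [Fintype F] (n z : ℕ) (J : F[X]) (S : Finset (MP F))
    (hS : Sm F z ⊆ S) :
    |(∑ f ∈ Md F n, muSqTrunc z f * muSqTrunc z (f + J))
      - (Fintype.card F : ℝ) ^ n * ∑ A ∈ Pz S z, ∑ B ∈ Pz S z,
          (-1) ^ A.card * (-1) ^ B.card * WW J A B| ≤ ((Pz S z).card : ℝ) ^ 2 := by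
  have e : (∑ f ∈ Md F n, muSqTrunc z f * muSqTrunc z (f + J))
      = ∑ A ∈ Pz S z, ∑ B ∈ Pz S z, (-1 : ℝ) ^ A.card * (-1) ^ B.card *
        (((Md F n).filter (fun f => pr A ^ 2 ∣ f ∧ pr B ^ 2 ∣ f + J)).card : ℝ) := by
    simp_rw [muSqTrunc_eq z S hS, Finset.sum_mul_sum]
    rw [Finset.sum_comm]
    apply Finset.sum_congr rfl
    intro A _
    rw [Finset.sum_comm]
    apply Finset.sum_congr rfl
    intro B _
    rw [Finset.card_filter]
    push_cast
    rw [Finset.mul_sum]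
    apply Finset.sum_congr rfl
    intro f _
    by_cases h1 : pr A ^ 2 ∣ f <;> by_cases h2 : pr B ^ 2 ∣ f + J <;> simp [h1, h2]
  rw [e, Finset.mul_sum, ← Finset.sum_sub_distrib]
  have hb : ((Pz S z).card : ℝ) ^ 2 = ∑ A ∈ Pz S z, ∑ B ∈ Pz S z, (1 : ℝ) := by
    simp [sq]
  rw [hb]
  refine (Finset.abs_sum_le_sum_abs _ _).trans (Finset.sum_le_sum fun A _ => ?_)
  rw [Finset.mul_sum, ← Finset.sum_sub_distrib]
  refine (Finset.abs_sum_le_sum_abs _ _).trans (Finset.sum_le_sum fun B _ => ?_)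
  have := count_AB n J A B
  rw [mul_left_comm, ← mul_sub, abs_mul, abs_mul, abs_pow, abs_pow]
  simpa using this

theorem card_Pz {F : Type} [Field F] [Fintype F] (z : ℕ) (S : Finset (MP F)) :
    ((Pz S z).card : ℝ) ≤ (Fintype.card F : ℝ) ^ z := by
  have h := sum_fin_le (Pz S z) pr pr_inj pr_monic (fun _ => 1) (fun _ => zero_le_one) z (by
    intro A hA
    rw [pr_natDegree]
    exact (Finset.mem_filter.1 hA).2)
  simp only [Finset.sum_const, nsmul_eq_mul, mul_one] at h
  refine h.trans ?_
  have := Nat.geomSum_lt (m := Fintype.card F) (n := z) (s := Finset.range z)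
    (Fintype.one_lt_card) (fun k hk => Finset.mem_range.1 hk)
  exact_mod_cast this.le

theorem euler_fin {ι : Type} [DecidableEq ι] (S : Finset ι) (x y : ι → ℝ) :
    ∑ A ∈ S.powerset, ∑ B ∈ S.powerset, (-1 : ℝ) ^ A.card * (-1) ^ B.card *
      ((∏ P ∈ A ∪ B, x P) * ∏ P ∈ A ∩ B, y P) = ∏ P ∈ S, (1 - 2 * x P + x P * y P) := by
  induction S using Finset.induction_on with
  | empty => simp
  | insert a S ha ih =>
    rw [Finset.prod_insert ha, ← ih, Finset.sum_powerset_insert ha]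
    simp_rw [Finset.sum_powerset_insert ha]
    rw [← Finset.sum_add_distrib, Finset.mul_sum]
    apply Finset.sum_congr rfl
    intro A hA
    simp_rw [← Finset.sum_add_distrib, Finset.mul_sum]
    apply Finset.sum_congr rfl
    intro B hB
    have hA' : a ∉ A := fun h => ha (Finset.mem_powerset.1 hA h)
    have hB' : a ∉ B := fun h => ha (Finset.mem_powerset.1 hB h)
    have e1 : A ∪ insert a B = insert a (A ∪ B) := Finset.union_insert _ _ _
    have e2 : insert a A ∪ B = insert a (A ∪ B) := Finset.insert_union _ _ _
    have e3 : insert a A ∪ insert a B = insert a (A ∪ B) := by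
      rw [Finset.insert_union, Finset.union_insert, Finset.insert_idem]
    have e4 : A ∩ insert a B = A ∩ B := Finset.inter_insert_of_notMem hA'
    have e5 : insert a A ∩ B = A ∩ B := Finset.insert_inter_of_notMem hB'
    have e6 : insert a A ∩ insert a B = insert a (A ∩ B) := (Finset.insert_inter_distrib _ _ _).symm
    have hu : a ∉ A ∪ B := by simp [hA', hB']
    have hi : a ∉ A ∩ B := by simp [hA']
    rw [e1, e2, e3, e4, e5, e6, Finset.prod_insert hu, Finset.prod_insert hi,
      Finset.card_insert_of_notMem hA', Finset.card_insert_of_notMem hB']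
    ring

theorem geo_le (r : ℝ) (h0 : 0 ≤ r) (h1 : r ≤ 1 / 3) (K : ℕ) :
    ∑ k ∈ Finset.range K, r ^ k ≤ 3 / 2 := by
  have h := geom_sum_mul r K
  have hp : 0 ≤ r ^ K := pow_nonneg h0 K
  have hs : 0 ≤ ∑ k ∈ Finset.range K, r ^ k := Finset.sum_nonneg fun k _ => pow_nonneg h0 k
  nlinarith

theorem geo_tail (r : ℝ) (h0 : 0 ≤ r) (h1 : r ≤ 1 / 3) (m K : ℕ) :
    ∑ k ∈ Finset.range K, (if m ≤ k then r ^ k else 0) ≤ 3 / 2 * r ^ m := by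
  rw [← Finset.sum_filter]
  have : (Finset.range K).filter (fun k => m ≤ k) = Finset.Ico m K := by
    ext k; simp [and_comm]
  rw [this, Finset.sum_Ico_eq_sum_range]
  simp_rw [pow_add]
  rw [← Finset.mul_sum, mul_comm]
  exact mul_le_mul_of_nonneg_right (geo_le r h0 h1 _) (pow_nonneg h0 m)

theorem geo_double (r : ℝ) (h0 : 0 ≤ r) (h1 : r ≤ 1 / 3) (z K : ℕ) :
    ∑ i ∈ Finset.range K, r ^ i * ∑ j ∈ Finset.range K, (if z ≤ i + j then r ^ j else 0)
      ≤ 3 / 2 * ((z + 3 / 2) * r ^ z) := by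
  have h2 : ∀ i, r ^ i * ∑ j ∈ Finset.range K, (if z ≤ i + j then r ^ j else 0)
      ≤ 3 / 2 * ((if i < z then r ^ z else 0) + (if z ≤ i then r ^ i else 0)) := by
    intro i
    have h3 := geo_tail r h0 h1 (z - i) K
    have h4 : ∑ j ∈ Finset.range K, (if z ≤ i + j then r ^ j else 0)
        = ∑ j ∈ Finset.range K, (if z - i ≤ j then r ^ j else 0) := by
      apply Finset.sum_congr rfl
      intro j _
      congr 1
      rw [eq_iff_iff]; omega
    rw [h4]
    refine (mul_le_mul_of_nonneg_left h3 (pow_nonneg h0 i)).trans ?_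
    apply le_of_eq
    rw [mul_left_comm, ← pow_add]
    rcases lt_or_ge i z with h | h
    · rw [if_pos h, if_neg (by omega), add_zero]; congr 2; omega
    · rw [if_neg (by omega), if_pos h, zero_add]; congr 2; omega
  refine (Finset.sum_le_sum fun i _ => h2 i).trans ?_
  rw [← Finset.mul_sum, Finset.sum_add_distrib]
  apply mul_le_mul_of_nonneg_left _ (by norm_num)
  rw [add_mul]
  apply add_le_add _ (geo_tail r h0 h1 z K)
  rw [← Finset.sum_filter, Finset.sum_const, nsmul_eq_mul]
  apply mul_le_mul_of_nonneg_right _ (pow_nonneg h0 z)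
  have : ((Finset.range K).filter (fun i => i < z)).card ≤ (Finset.range z).card := by
    apply Finset.card_le_card
    intro i hi
    rw [Finset.mem_filter] at hi
    exact Finset.mem_range.2 hi.2
  rw [Finset.card_range] at this
  exact_mod_cast this

noncomputable def xi (F : Type) [Field F] [Fintype F] (k : ℕ) : ℝ :=
  1 / ((Fintype.card F : ℝ) ^ k) ^ 2

theorem xi_nonneg (F : Type) [Field F] [Fintype F] (k : ℕ) : 0 ≤ xi F k := by
  unfold xi; positivity

theorem q_xi (F : Type) [Field F] [Fintype F] (k : ℕ) :
    (Fintype.card F : ℝ) ^ k * xi F k = (1 / (Fintype.card F : ℝ)) ^ k := by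
  unfold xi
  have : (Fintype.card F : ℝ) ^ k ≠ 0 := by positivity
  rw [one_div_pow]
  field_simp

open scoped Classical in
theorem tail_half {F : Type} [Field F] [Fintype F] (hq : (3 : ℝ) ≤ Fintype.card F) (z : ℕ)
    (S : Finset (MP F)) :
    ∑ p ∈ S.powerset ×ˢ S.powerset, (if z ≤ dg p.1 then ∏ P ∈ p.1 ∪ p.2, xx P else 0)
      ≤ 9 / 4 * ((z + 3 / 2) * (1 / (Fintype.card F : ℝ)) ^ z) := by
  set r : ℝ := 1 / (Fintype.card F : ℝ) with hr
  have h0 : 0 ≤ r := by positivity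
  have h1 : r ≤ 1 / 3 := one_div_le_one_div_of_le (by norm_num) hq
  let φ : Finset (MP F) × Finset (MP F) → Finset (MP F) × Finset (MP F) × Finset (MP F) :=
    fun p => (p.1 ∩ p.2, p.1 \ p.2, p.2 \ p.1)
  have hφ : Function.Injective φ := by
    rintro ⟨A, B⟩ ⟨A', B'⟩ h
    simp only [φ, Prod.mk.injEq] at h
    obtain ⟨h1, h2, h3⟩ := h
    have e1 : A = A' := by
      rw [← Finset.sdiff_union_inter A B, ← Finset.sdiff_union_inter A' B', h1, h2]
    have e2 : B = B' := by
      rw [← Finset.sdiff_union_inter B A, ← Finset.sdiff_union_inter B' A', h3,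
        Finset.inter_comm B, Finset.inter_comm B', h1]
    rw [e1, e2]
  let g : Finset (MP F) × Finset (MP F) × Finset (MP F) → ℝ := fun t =>
    xi F (dg t.1) * ((if z ≤ dg t.1 + dg t.2.1 then xi F (dg t.2.1) else 0) * xi F (dg t.2.2))
  have hg0 : ∀ t, 0 ≤ g t := by
    intro t
    refine mul_nonneg (xi_nonneg _ _) (mul_nonneg ?_ (xi_nonneg _ _))
    split_ifs
    · exact xi_nonneg _ _
    · exact le_rfl
  have hgp : ∀ p, (if z ≤ dg p.1 then ∏ P ∈ p.1 ∪ p.2, xx P else 0) = g (φ p) := by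
    rintro ⟨A, B⟩
    simp only [g, φ]
    have e1 : dg (A ∩ B) + dg (A \ B) = dg A := Finset.sum_inter_add_sum_sdiff _ _ _
    have e3 : dg A + dg (B \ A) = dg (A ∪ B) := by
      rw [← Finset.union_sdiff_self_eq_union]
      exact (Finset.sum_union Finset.disjoint_sdiff).symm
    rw [e1, prod_xx, ← e3, ← e1]
    split_ifs
    · unfold xi
      rw [pow_add, pow_add]
      field_simp
    · simp
  calc ∑ p ∈ S.powerset ×ˢ S.powerset, (if z ≤ dg p.1 then ∏ P ∈ p.1 ∪ p.2, xx P else 0)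
      = ∑ p ∈ S.powerset ×ˢ S.powerset, g (φ p) := Finset.sum_congr rfl fun p _ => hgp p
    _ = ∑ t ∈ (S.powerset ×ˢ S.powerset).image φ, g t := (Finset.sum_image hφ.injOn).symm
    _ ≤ ∑ t ∈ S.powerset ×ˢ S.powerset ×ˢ S.powerset, g t := by
        apply Finset.sum_le_sum_of_subset_of_nonneg
        · intro t ht
          obtain ⟨⟨A, B⟩, hp, rfl⟩ := Finset.mem_image.1 ht
          simp only [Finset.mem_product, Finset.mem_powerset, φ] at hp ⊢
          exact ⟨Finset.inter_subset_left.trans hp.1, Finset.sdiff_subset.trans hp.1,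
            Finset.sdiff_subset.trans hp.2⟩
        · intro t _ _
          exact hg0 t
    _ = ∑ G ∈ S.powerset, xi F (dg G) * ((∑ A ∈ S.powerset,
          (if z ≤ dg G + dg A then xi F (dg A) else 0)) * ∑ B ∈ S.powerset, xi F (dg B)) := by
        rw [Finset.sum_product]
        apply Finset.sum_congr rfl
        intro G _
        rw [Finset.sum_mul_sum, Finset.sum_product, Finset.mul_sum]
        apply Finset.sum_congr rfl
        intro A _
        rw [Finset.mul_sum]
    _ ≤ ∑ G ∈ S.powerset, xi F (dg G) * ((∑ j ∈ Finset.range (dg S + 1),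
          (if z ≤ dg G + j then r ^ j else 0)) * (3 / 2)) := by
        apply Finset.sum_le_sum
        intro G _
        apply mul_le_mul_of_nonneg_left _ (xi_nonneg _ _)
        apply mul_le_mul
        · refine (sum_powerset_le_s17 S (fun k => if z ≤ dg G + k then xi F k else 0) ?_).trans ?_
          · intro k
            split_ifs
            · exact xi_nonneg _ _
            · exact le_rfl
          · apply Finset.sum_le_sum
            intro k _
            rw [mul_ite, q_xi, mul_zero]
        · refine (sum_powerset_le_s17 S (xi F) (xi_nonneg F)).trans ?_
          simp_rw [q_xi]
          exact geo_le r h0 h1 _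
        · exact Finset.sum_nonneg fun _ _ => xi_nonneg _ _
        · refine Finset.sum_nonneg fun _ _ => ?_
          split_ifs <;> positivity
    _ ≤ ∑ i ∈ Finset.range (dg S + 1), (Fintype.card F : ℝ) ^ i * (xi F i * ((∑ j ∈ Finset.range (dg S + 1),
          (if z ≤ i + j then r ^ j else 0)) * (3 / 2))) := by
        apply sum_powerset_le_s17 S (fun i => (xi F i * ((∑ j ∈ Finset.range (dg S + 1),
          (if z ≤ i + j then r ^ j else 0)) * (3 / 2))))
        intro k
        refine mul_nonneg (xi_nonneg _ _) (mul_nonneg (Finset.sum_nonneg fun _ _ => ?_) (by norm_num))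
        split_ifs <;> positivity
    _ = 3 / 2 * ∑ i ∈ Finset.range (dg S + 1), r ^ i * ∑ j ∈ Finset.range (dg S + 1),
          (if z ≤ i + j then r ^ j else 0) := by
        rw [Finset.mul_sum]
        apply Finset.sum_congr rfl
        intro i _
        rw [← mul_assoc, q_xi]
        ring
    _ ≤ 3 / 2 * (3 / 2 * ((z + 3 / 2) * r ^ z)) :=
        mul_le_mul_of_nonneg_left (geo_double r h0 h1 z _) (by norm_num)
    _ = _ := by ring

open scoped Classical in
theorem tail_bound {F : Type} [Field F] [Fintype F] (hq : (3 : ℝ) ≤ Fintype.card F) (z : ℕ)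
    (hz : 0 < z) (J : F[X]) (S : Finset (MP F)) :
    |(∑ A ∈ Pz S z, ∑ B ∈ Pz S z, (-1) ^ A.card * (-1) ^ B.card * WW J A B)
      - ∏ P ∈ S, (1 - 2 * xx P + xx P * yy J P)| ≤ 12 * (z / (Fintype.card F : ℝ) ^ z) := by
  rw [← euler_fin, abs_sub_comm, ← Finset.sum_product', ← Finset.sum_product']
  have hsub : Pz S z ×ˢ Pz S z ⊆ S.powerset ×ˢ S.powerset :=
    Finset.product_subset_product (Finset.filter_subset _ _) (Finset.filter_subset _ _)
  rw [← Finset.sum_sdiff hsub]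
  unfold WW
  rw [add_sub_cancel_right]
  have hx : ∀ P : MP F, 0 ≤ xx P := fun P => by unfold xx; positivity
  have hv : ∀ A : Finset (MP F), 0 ≤ ∏ P ∈ A, xx P := fun A => Finset.prod_nonneg fun P _ => hx P
  have hsw : ∑ p ∈ S.powerset ×ˢ S.powerset, (if z ≤ dg p.2 then ∏ P ∈ p.1 ∪ p.2, xx P else 0)
      = ∑ p ∈ S.powerset ×ˢ S.powerset, (if z ≤ dg p.1 then ∏ P ∈ p.1 ∪ p.2, xx P else 0) := by
    rw [Finset.sum_product, Finset.sum_product_right]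
    simp_rw [Finset.union_comm]
  have ht := tail_half hq z S
  calc _ ≤ ∑ p ∈ (S.powerset ×ˢ S.powerset) \ (Pz S z ×ˢ Pz S z),
        ((if z ≤ dg p.1 then ∏ P ∈ p.1 ∪ p.2, xx P else 0)
          + (if z ≤ dg p.2 then ∏ P ∈ p.1 ∪ p.2, xx P else 0)) := by
        refine (Finset.abs_sum_le_sum_abs _ _).trans (Finset.sum_le_sum ?_)
        rintro ⟨A, B⟩ hp
        have hy : ∏ P ∈ A ∩ B, yy J P ≤ 1 := by
          rw [prod_yy]; split_ifs <;> norm_num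
        have hy0 : 0 ≤ ∏ P ∈ A ∩ B, yy J P := by
          rw [prod_yy]; split_ifs <;> norm_num
        have h1 : |(-1 : ℝ) ^ A.card * (-1) ^ B.card * ((∏ P ∈ A ∪ B, xx P) * ∏ P ∈ A ∩ B, yy J P)|
            ≤ ∏ P ∈ A ∪ B, xx P := by
          rw [abs_mul, abs_mul, abs_pow, abs_pow, abs_neg, abs_one, one_pow, one_pow, one_mul,
            one_mul, abs_of_nonneg (mul_nonneg (hv _) hy0)]
          exact mul_le_of_le_one_right (hv _) hy
        refine h1.trans ?_
        have hor : z ≤ dg A ∨ z ≤ dg B := by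
          by_contra! hcon
          simp only [Finset.mem_sdiff, Finset.mem_product, Pz, Finset.mem_filter] at hp
          tauto
        have := hv (A ∪ B)
        dsimp only
        rcases hor with h | h
        · rw [if_pos h]; split_ifs <;> linarith
        · rw [if_pos h]; split_ifs <;> linarith
    _ ≤ ∑ p ∈ (S.powerset ×ˢ S.powerset),
        ((if z ≤ dg p.1 then ∏ P ∈ p.1 ∪ p.2, xx P else 0)
          + (if z ≤ dg p.2 then ∏ P ∈ p.1 ∪ p.2, xx P else 0)) := by
        apply Finset.sum_le_sum_of_subset_of_nonneg Finset.sdiff_subset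
        intro p _ _
        have := hv (p.1 ∪ p.2)
        split_ifs <;> linarith
    _ ≤ 2 * (9 / 4 * ((z + 3 / 2) * (1 / (Fintype.card F : ℝ)) ^ z)) := by
        rw [Finset.sum_add_distrib, hsw]; linarith
    _ ≤ _ := by
        have hz' : (1 : ℝ) ≤ z := by exact_mod_cast hz
        rw [one_div_pow, div_eq_mul_one_div (z : ℝ)]
        have : 0 ≤ 1 / (Fintype.card F : ℝ) ^ z := by positivity
        nlinarith

theorem xx_le {F : Type} [Field F] [Fintype F] (hq : (3 : ℝ) ≤ Fintype.card F) (P : MP F) :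
    xx P ≤ 1 / 9 := by
  unfold xx
  apply one_div_le_one_div_of_le (by norm_num)
  have h1 : (3 : ℝ) ≤ (Fintype.card F : ℝ) ^ P.1.natDegree := by
    have := P.2.2.natDegree_pos
    calc (3 : ℝ) ≤ Fintype.card F := hq
      _ = (Fintype.card F : ℝ) ^ 1 := (pow_one _).symm
      _ ≤ _ := pow_le_pow_right₀ (by linarith) this
  nlinarith

theorem xx_summable {F : Type} [Field F] [Fintype F] (hq : (3 : ℝ) ≤ Fintype.card F) :
    Summable (xx (F := F)) := by
  apply summable_of_sum_le (c := 3 / 2)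
  · intro P; unfold xx; positivity
  · intro S
    have h := sum_fin_le S Subtype.val Subtype.val_injective (fun P => P.2.1) (xi F) (xi_nonneg F)
      (S.sup (fun P => P.1.natDegree) + 1) (by
        intro P hP
        exact Nat.lt_succ_of_le (Finset.le_sup (f := fun P : MP F => P.1.natDegree) hP))
    simp_rw [q_xi] at h
    refine le_trans h (geo_le _ (by positivity) (one_div_le_one_div_of_le (by norm_num) hq) _)

open Filter Topology in
theorem sing_tendsto {F : Type} [Field F] [Fintype F] (hq : (3 : ℝ) ≤ Fintype.card F)
    (J : F[X]) (hJ : J ≠ 0) :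
    Tendsto (fun S : Finset (MP F) => ∏ P ∈ S, (1 - 2 * xx P + xx P * yy J P)) atTop
      (𝓝 (singSeries J)) := by
  classical
  have hT : {P : MP F | P.1 ^ 2 ∣ J}.Finite := by
    refine (small_finite F (J.natDegree + 1)).subset ?_
    intro P hP
    have := natDegree_le_of_dvd ((dvd_pow_self P.1 two_ne_zero).trans hP) hJ
    exact Nat.lt_succ_of_le this
  let c : MP F → ℝ := fun P => (1 - xx P) / (1 - 2 * xx P)
  have hm : Multipliable (fun P : MP F => 1 - 2 * xx P) := by
    have := Real.multipliable_one_add_of_summable ((xx_summable hq).mul_left (-2))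
    refine this.congr ?_
    intro P; ring
  have hs : singSeries J = (∏' P : MP F, (1 - 2 * xx P)) * ∏ P ∈ hT.toFinset, c P := by
    unfold singSeries
    congr 1
    · apply tprod_congr
      intro P
      unfold xx; ring
    · have e : {P : F[X] | P.Monic ∧ Irreducible P ∧ P ^ 2 ∣ J}
          = ↑(hT.toFinset.image Subtype.val) := by
        ext P
        simp
        tauto
      rw [e, finprod_mem_coe_finset, Finset.prod_image Subtype.val_injective.injOn]
      apply Finset.prod_congr rfl
      intro P _
      have h1 := xx_le hq P
      have h2 : ((Fintype.card F : ℝ) ^ P.1.natDegree) ^ 2 ≠ 0 := by positivity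
      have h3 : xx P = 1 / ((Fintype.card F : ℝ) ^ P.1.natDegree) ^ 2 := rfl
      simp only [c]
      rw [h3]
      field_simp
  rw [hs]
  refine (hm.hasProd.mul_const (∏ P ∈ hT.toFinset, c P)).congr' ?_
  filter_upwards [eventually_ge_atTop hT.toFinset] with S hS
  have : ∏ P ∈ hT.toFinset, c P = ∏ P ∈ S, if P.1 ^ 2 ∣ J then c P else 1 := by
    rw [← Finset.prod_filter]
    apply Finset.prod_congr _ (fun _ _ => rfl)
    ext P
    simp only [Set.Finite.mem_toFinset, Finset.mem_filter]
    constructor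
    · intro h
      exact ⟨hS ((Set.Finite.mem_toFinset _).2 h), h⟩
    · exact fun h => h.2
  rw [this, ← Finset.prod_mul_distrib]
  apply Finset.prod_congr rfl
  intro P _
  unfold yy
  have h1 := xx_le hq P
  have h2 : 1 - 2 * xx P ≠ 0 := by linarith
  split_ifs
  · simp only [c]; field_simp; ring
  · ring

/-- there is an absolute constant `C` such that for every finite field `𝔽_q`
with `q` odd, all `n ≥ 2`, `0 < z ≤ n/2` and `0 ≠ J` with `deg J < n`,
`|S_z(J;n) - qⁿ 𝔖(J)| ≤ C (qⁿ z/q^z + q^{2z})` with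
`S_z(J;n) = ∑_{f ∈ M_n} μ²_z(f)μ²_z(f+J)`. -/
theorem squarefree_pair_truncated_main_term : ∃ C : ℝ,
    ∀ (Fq : Type) [Field Fq] [Fintype Fq], Odd (Fintype.card Fq) →
    ∀ n z : ℕ, 2 ≤ n → 0 < z → 2 * z ≤ n → ∀ J : Fq[X], J ≠ 0 → J.natDegree < n →
      |(∑ᶠ f ∈ {f : Fq[X] | f.Monic ∧ f.natDegree = n}, muSqTrunc z f * muSqTrunc z (f + J))
          - (Fintype.card Fq : ℝ) ^ n * singSeries J|
        ≤ C * ((Fintype.card Fq : ℝ) ^ n * z / (Fintype.card Fq : ℝ) ^ z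
            + (Fintype.card Fq : ℝ) ^ (2 * z)) := by
  refine ⟨12, ?_⟩
  intro Fq _ _ hodd n z _ hz _ J hJ _
  have hq : (3 : ℝ) ≤ Fintype.card Fq := by
    have h1 : 1 < Fintype.card Fq := Fintype.one_lt_card
    obtain ⟨k, hk⟩ := hodd
    have : 3 ≤ Fintype.card Fq := by omega
    exact_mod_cast this
  have e : (∑ᶠ f ∈ {f : Fq[X] | f.Monic ∧ f.natDegree = n}, muSqTrunc z f * muSqTrunc z (f + J))
      = ∑ f ∈ Md Fq n, muSqTrunc z f * muSqTrunc z (f + J) :=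
    finsum_mem_eq_finite_toFinset_sum _ (Md_finite Fq n)
  rw [e]
  have ht := ((((sing_tendsto hq J hJ).const_mul ((Fintype.card Fq : ℝ) ^ n)).const_sub
    (∑ f ∈ Md Fq n, muSqTrunc z f * muSqTrunc z (f + J)))).abs
  refine le_of_tendsto ht ?_
  filter_upwards [Filter.eventually_ge_atTop (Sm Fq z)] with S hS
  have h1 := main_sum n z J S hS
  have h2 := tail_bound hq z hz J S
  have h3 := card_Pz z S
  have h4 : ((Pz S z).card : ℝ) ^ 2 ≤ (Fintype.card Fq : ℝ) ^ (2 * z) := by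
    rw [mul_comm, pow_mul]
    exact pow_le_pow_left₀ (by positivity) h3 2
  have h5 : 0 ≤ (Fintype.card Fq : ℝ) ^ (2 * z) := by positivity
  have h6 := mul_le_mul_of_nonneg_left h2 (by positivity : 0 ≤ (Fintype.card Fq : ℝ) ^ n)
  rw [← abs_of_nonneg (by positivity : 0 ≤ (Fintype.card Fq : ℝ) ^ n), ← abs_mul, mul_sub,
    abs_of_nonneg (by positivity : 0 ≤ (Fintype.card Fq : ℝ) ^ n)] at h6
  refine (abs_sub_le _ _ _).trans ((add_le_add h1 h6).trans ?_)
  have h7 : (Fintype.card Fq : ℝ) ^ n * (12 * (z / (Fintype.card Fq : ℝ) ^ z))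
      = 12 * ((Fintype.card Fq : ℝ) ^ n * z / (Fintype.card Fq : ℝ) ^ z) := by ring
  rw [h7]
  linarith
end

section
/- For every nonzero J ∈ 𝔽_q[t], the absolutely convergent double series over pairs of monic polynomials satisfies Σ_{d₁ monic} Σ_{d₂ monic} μ(d₁)·μ(d₂)·κ(d₁,d₂;J)/|lcm(d₁,d₂)|² = 𝔖(J), where κ(d₁,d₂;J) = 1 if gcd(d₁,d₂)² divides J and κ(d₁,d₂;J) = 0 otherwise, and 𝔖(J) = ∏_P (1 − 2/|P|²) · ∏_{P : P²∣J} (|P|²−1)/(|P|²−2), the products over monic irreducible P ∈ 𝔽_q[t]. -/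
open Polynomial

section Abstract
open scoped Classical
open Filter Topology

noncomputable def pairTerm {ι : Type*} (s : ℝ) (k x : ι → ℝ) (p : Finset ι × Finset ι) : ℝ :=
  s ^ p.1.card * s ^ p.2.card * (∏ i ∈ p.1 ∩ p.2, k i) * ∏ i ∈ p.1 ∪ p.2, x i

lemma pairTerm_sum {ι : Type*} (s : ℝ) (k x : ι → ℝ) (U : Finset ι) :
    ∑ p ∈ U.powerset ×ˢ U.powerset, pairTerm s k x p
      = ∏ i ∈ U, (1 + (2 * s * x i + s ^ 2 * k i * x i)) := by
  rw [Finset.sum_product]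
  induction U using Finset.induction_on with
  | empty => simp [pairTerm]
  | insert a U ha ih =>
    rw [Finset.prod_insert ha, ← ih, Finset.sum_powerset_insert ha]
    simp_rw [Finset.sum_powerset_insert ha]
    rw [← Finset.sum_add_distrib, Finset.mul_sum]
    refine Finset.sum_congr rfl fun S hS => ?_
    rw [← Finset.sum_add_distrib, ← Finset.sum_add_distrib, ← Finset.sum_add_distrib,
      Finset.mul_sum]
    refine Finset.sum_congr rfl fun T hT => ?_
    have h1 : a ∉ S := fun h => ha (Finset.mem_powerset.1 hS h)
    have h2 : a ∉ T := fun h => ha (Finset.mem_powerset.1 hT h)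
    have e1 : insert a S ∩ T = S ∩ T := Finset.insert_inter_of_notMem h2
    have e2 : S ∩ insert a T = S ∩ T := Finset.inter_insert_of_notMem h1
    have e3 : insert a S ∩ insert a T = insert a (S ∩ T) := (Finset.insert_inter_distrib _ _ _).symm
    have e4 : insert a S ∪ T = insert a (S ∪ T) := Finset.insert_union _ _ _
    have e5 : S ∪ insert a T = insert a (S ∪ T) := Finset.union_insert _ _ _
    have e6 : insert a S ∪ insert a T = insert a (S ∪ T) := (Finset.insert_union_distrib _ _ _).symm
    have h3 : a ∉ S ∩ T := by simp [h1]
    have h4 : a ∉ S ∪ T := by simp [h1, h2]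
    simp only [pairTerm, e1, e2, e3, e4, e5, e6, Finset.prod_insert h3, Finset.prod_insert h4,
      Finset.card_insert_of_notMem h1, Finset.card_insert_of_notMem h2]
    ring

lemma pow_tendsto {ι : Type*} :
    Tendsto (fun U : Finset ι => U.powerset ×ˢ U.powerset) atTop atTop := by
  refine tendsto_atTop_finset_of_monotone ?_ ?_
  · intro U V h
    exact Finset.product_subset_product (Finset.powerset_mono.2 h) (Finset.powerset_mono.2 h)
  · rintro ⟨S, T⟩
    exact ⟨S ∪ T, by
      rw [Finset.mem_product, Finset.mem_powerset, Finset.mem_powerset]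
      exact ⟨Finset.subset_union_left, Finset.subset_union_right⟩⟩

lemma pairTerm_summable {ι : Type*} (k x : ι → ℝ) (hk : ∀ i, 0 ≤ k i) (hk1 : ∀ i, k i ≤ 1)
    (hx : ∀ i, 0 ≤ x i) (hs : Summable x) : Summable (pairTerm (-1) k x) := by
  have hnn : ∀ p, 0 ≤ pairTerm 1 k x p := fun p => by
    unfold pairTerm
    have := Finset.prod_nonneg (s := p.1 ∩ p.2) fun i _ => hk i
    have := Finset.prod_nonneg (s := p.1 ∪ p.2) fun i _ => hx i
    positivity
  have h1 : Summable (pairTerm 1 k x) := by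
    refine summable_of_sum_le (c := Real.exp (∑' i, 3 * x i)) hnn fun F => ?_
    obtain ⟨U, hU⟩ := ((pow_tendsto (ι := ι)).eventually (eventually_ge_atTop F)).exists
    calc _ ≤ ∑ p ∈ U.powerset ×ˢ U.powerset, pairTerm 1 k x p :=
          Finset.sum_le_sum_of_subset_of_nonneg hU fun p _ _ => hnn p
      _ = _ := pairTerm_sum 1 k x U
      _ ≤ ∏ i ∈ U, Real.exp (3 * x i) := by
          refine Finset.prod_le_prod (fun i _ => ?_) fun i _ => ?_
          · have := hk i; have := hx i; positivity
          · refine le_trans ?_ (Real.add_one_le_exp _)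
            nlinarith [mul_le_mul_of_nonneg_right (hk1 i) (hx i)]
      _ = Real.exp (∑ i ∈ U, 3 * x i) := (Real.exp_sum _ _).symm
      _ ≤ _ := Real.exp_le_exp.2 ((hs.mul_left 3).sum_le_tsum U
          fun i _ => mul_nonneg (by norm_num) (hx i))
  refine Summable.of_norm_bounded h1 fun p => le_of_eq ?_
  rw [← abs_of_nonneg (hnn p), Real.norm_eq_abs]
  simp [pairTerm, abs_mul]

lemma pairTerm_tsum {ι : Type*} (k x : ι → ℝ) (hk : ∀ i, 0 ≤ k i) (hk1 : ∀ i, k i ≤ 1)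
    (hx : ∀ i, 0 ≤ x i) (hs : Summable x) :
    ∑' p, pairTerm (-1) k x p = ∏' i, (1 + (-2 * x i + k i * x i)) := by
  have h1 := (pairTerm_summable k x hk hk1 hx hs).hasSum.comp pow_tendsto
  have hsk : Summable fun i => k i * x i := Summable.of_nonneg_of_le
    (fun i => mul_nonneg (hk i) (hx i)) (fun i => mul_le_of_le_one_left (hx i) (hk1 i)) hs
  have h2 := (Real.multipliable_one_add_of_summable ((hs.mul_left (-2)).add hsk)).hasProd
  refine tendsto_nhds_unique h1 (Tendsto.congr (fun U => ?_) h2)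
  rw [Function.comp, pairTerm_sum]
  refine Finset.prod_congr rfl fun i _ => by ring

end Abstract

section Poly
open scoped Classical
open Filter Topology
variable {Fq : Type} [Field Fq]

abbrev MPrime (Fq : Type) [Field Fq] := {P : Fq[X] // P.Monic ∧ Irreducible P}

lemma degLT_bd [Fintype Fq] (n : ℕ) : Finite {p : Fq[X] // p.natDegree = n} ∧
    Nat.card {p : Fq[X] // p.natDegree = n} ≤ Fintype.card Fq ^ (n + 1) := by
  let f : {p : Fq[X] // p.natDegree = n} → (Fin (n + 1) → Fq) := fun p i => p.1.coeff i
  have hf : Function.Injective f := by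
    rintro ⟨p, hp⟩ ⟨q, hq⟩ h
    refine Subtype.ext (Polynomial.ext fun i => ?_)
    by_cases hi : i < n + 1
    · exact congrFun h ⟨i, hi⟩
    · show p.coeff i = q.coeff i
      rw [Polynomial.coeff_eq_zero_of_natDegree_lt (by omega),
        Polynomial.coeff_eq_zero_of_natDegree_lt (by omega)]
  refine ⟨Finite.of_injective f hf, ?_⟩
  have := Nat.card_le_card_of_injective f hf
  simpa [Nat.card_eq_fintype_card] using this

lemma poly_summable [Fintype Fq] :
    Summable fun p : Fq[X] => 1 / ((Fintype.card Fq : ℝ) ^ p.natDegree) ^ 2 := by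
  have hq : (1 : ℝ) < Fintype.card Fq := by exact_mod_cast Fintype.one_lt_card
  have hq0 : (0 : ℝ) < Fintype.card Fq := by linarith
  rw [← (Equiv.sigmaFiberEquiv (fun p : Fq[X] => p.natDegree)).summable_iff,
    summable_sigma_of_nonneg (fun x => by simp only [Function.comp]; positivity)]
  have e : ∀ n : ℕ, (fun y : {p : Fq[X] // p.natDegree = n} =>
      ((fun p : Fq[X] => 1 / ((Fintype.card Fq : ℝ) ^ p.natDegree) ^ 2) ∘
        (Equiv.sigmaFiberEquiv (fun p : Fq[X] => p.natDegree))) ⟨n, y⟩)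
      = fun _ => 1 / ((Fintype.card Fq : ℝ) ^ n) ^ 2 := by
    intro n
    funext y
    simp [Equiv.sigmaFiberEquiv, y.2]
  constructor
  · intro n
    have := (degLT_bd (Fq := Fq) n).1
    exact Summable.of_finite
  · simp_rw [e]
    refine Summable.of_nonneg_of_le (f := fun n => (Fintype.card Fq : ℝ) *
      ((Fintype.card Fq : ℝ)⁻¹) ^ n)
      (fun n => tsum_nonneg fun _ => by positivity) (fun n => ?_)
      ((summable_geometric_of_lt_one (by positivity) (inv_lt_one_of_one_lt₀ hq)).mul_left _)
    obtain ⟨h1, h2⟩ := degLT_bd (Fq := Fq) n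
    rw [tsum_const, nsmul_eq_mul]
    have h3 : (Nat.card {p : Fq[X] // p.natDegree = n} : ℝ) ≤ (Fintype.card Fq : ℝ) ^ (n + 1) := by
      exact_mod_cast h2
    refine (mul_le_mul_of_nonneg_right h3 (by positivity)).trans (le_of_eq ?_)
    rw [inv_pow]
    field_simp
    ring

noncomputable def Phi (S : Finset (MPrime Fq)) : Fq[X] := ∏ P ∈ S, (P : Fq[X])

lemma Phi_monic (S : Finset (MPrime Fq)) : (Phi S).Monic :=
  Polynomial.monic_prod_of_monic _ _ fun P _ => P.2.1

lemma MPrime.coprime {P Q : MPrime Fq} (h : P ≠ Q) : IsCoprime (P : Fq[X]) (Q : Fq[X]) := by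
  rcases (EuclideanDomain.dvd_or_coprime (P : Fq[X]) (Q : Fq[X]) P.2.2).symm with h1 | h1
  · exact h1
  · exact absurd (Subtype.ext (Polynomial.eq_of_monic_of_associated P.2.1 Q.2.1
      (P.2.2.associated_of_dvd Q.2.2 h1))) h

lemma Phi_dvd {S : Finset (MPrime Fq)} {z : Fq[X]} (h : ∀ P ∈ S, (P : Fq[X]) ∣ z) : Phi S ∣ z :=
  Finset.prod_dvd_of_coprime (fun _ _ _ _ h => MPrime.coprime h) h

lemma dvd_Phi {S : Finset (MPrime Fq)} {P : MPrime Fq} : (P : Fq[X]) ∣ Phi S ↔ P ∈ S := by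
  constructor
  · intro h
    obtain ⟨Q, hQ, h1⟩ := (Prime.dvd_finsetProd_iff P.2.2.prime _).1 h
    have : P = Q := Subtype.ext (Polynomial.eq_of_monic_of_associated P.2.1 Q.2.1
      (P.2.2.associated_of_dvd Q.2.2 h1))
    exact this ▸ hQ
  · exact fun h => Finset.dvd_prod_of_mem _ h

lemma Phi_inj : Function.Injective (Phi (Fq := Fq)) := fun S T h => by
  ext P
  rw [← dvd_Phi, h, dvd_Phi]

lemma Phi_sq (S : Finset (MPrime Fq)) : Squarefree (Phi S) :=
  Finset.squarefree_prod_of_pairwise_isCoprime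
    (fun _ _ _ _ h => (MPrime.coprime h).isRelPrime) fun P _ => P.2.2.squarefree

lemma Phi_mu (S : Finset (MPrime Fq)) : polyMu (Phi S) = (-1) ^ S.card := by
  rw [polyMu, if_pos (Phi_sq S)]
  congr 1
  have := UniqueFactorizationMonoid.factors_unique (f := UniqueFactorizationMonoid.factors (Phi S))
    (g := Multiset.map (fun P : MPrime Fq => P.1) S.val)
    (fun x hx => UniqueFactorizationMonoid.irreducible_of_factor x hx)
    (fun x hx => by
      obtain ⟨P, _, rfl⟩ := Multiset.mem_map.1 hx
      exact P.2.2)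
    (UniqueFactorizationMonoid.factors_prod (Phi_monic S).ne_zero)
  rw [Multiset.card_eq_card_of_rel this]
  simp

lemma Phi_surj {d : Fq[X]} (hd : d.Monic) (hs : Squarefree d) : ∃ S, Phi S = d := by
  have h0 := hd.ne_zero
  have key : ∀ P ∈ UniqueFactorizationMonoid.normalizedFactors d, P.Monic ∧ Irreducible P := by
    intro P hP
    have h := (UniqueFactorizationMonoid.mem_normalizedFactors_iff' h0).1 hP
    exact ⟨h.2.1 ▸ Polynomial.monic_normalize h.1.ne_zero, h.1⟩
  have hn := (UniqueFactorizationMonoid.squarefree_iff_nodup_normalizedFactors h0).1 hs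
  refine ⟨(UniqueFactorizationMonoid.normalizedFactors d).toFinset.subtype _, ?_⟩
  refine Polynomial.eq_of_monic_of_associated (Phi_monic _) hd ?_
  refine Associated.trans (Associated.of_eq ?_)
    (UniqueFactorizationMonoid.prod_normalizedFactors h0)
  unfold Phi
  rw [Finset.prod_subtype_of_mem (fun P : Fq[X] => P) (fun P hP => key P (Multiset.mem_toFinset.1 hP)),
    Finset.prod_eq_multiset_prod, Multiset.toFinset_val, hn.dedup, Multiset.map_id']

lemma Phi_lcm (S T : Finset (MPrime Fq)) :
    Associated (EuclideanDomain.lcm (Phi S) (Phi T)) (Phi (S ∪ T)) := by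
  refine associated_of_dvd_dvd (EuclideanDomain.lcm_dvd ?_ ?_) (Phi_dvd fun P hP => ?_)
  · exact Finset.prod_dvd_prod_of_subset _ _ _ Finset.subset_union_left
  · exact Finset.prod_dvd_prod_of_subset _ _ _ Finset.subset_union_right
  · rcases Finset.mem_union.1 hP with h | h
    · exact (dvd_Phi.2 h).trans (EuclideanDomain.dvd_lcm_left _ _)
    · exact (dvd_Phi.2 h).trans (EuclideanDomain.dvd_lcm_right _ _)

lemma Phi_gcd (S T : Finset (MPrime Fq)) :
    Associated (EuclideanDomain.gcd (Phi S) (Phi T)) (Phi (S ∩ T)) := by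
  refine Associated.of_mul_right (b := EuclideanDomain.lcm (Phi S) (Phi T)) (d := Phi (S ∪ T))
    (Associated.of_eq ?_) (Phi_lcm S T) ?_
  · rw [EuclideanDomain.gcd_mul_lcm, mul_comm (Phi (S ∩ T))]
    exact Finset.prod_union_inter.symm
  · exact (Phi_lcm S T).symm.ne_zero_iff.1 (Phi_monic _).ne_zero

lemma Phi_sq_dvd (S : Finset (MPrime Fq)) (J : Fq[X]) :
    Phi S ^ 2 ∣ J ↔ ∀ P ∈ S, (P : Fq[X]) ^ 2 ∣ J := by
  constructor
  · exact fun h P hP => (pow_dvd_pow_of_dvd (dvd_Phi.2 hP) 2).trans h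
  · intro h
    rw [Phi, ← Finset.prod_pow]
    exact Finset.prod_dvd_of_coprime (fun _ _ _ _ h => (MPrime.coprime h).pow) h

noncomputable def xN [Fintype Fq] (P : MPrime Fq) : ℝ :=
  1 / ((Fintype.card Fq : ℝ) ^ (P : Fq[X]).natDegree) ^ 2

noncomputable def kJ (J : Fq[X]) (P : MPrime Fq) : ℝ := if (P : Fq[X]) ^ 2 ∣ J then 1 else 0

lemma Phi_term [Fintype Fq] (J : Fq[X]) (S T : Finset (MPrime Fq)) :
    (polyMu (Phi S) : ℝ) * (polyMu (Phi T) : ℝ) *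
          (if (EuclideanDomain.gcd (Phi S) (Phi T)) ^ 2 ∣ J then (1 : ℝ) else 0) /
          ((Fintype.card Fq : ℝ) ^
              (EuclideanDomain.lcm (Phi S) (Phi T)).natDegree) ^ 2
      = pairTerm (-1) (kJ J) xN (S, T) := by
  have h1 : (if (EuclideanDomain.gcd (Phi S) (Phi T)) ^ 2 ∣ J then (1 : ℝ) else 0)
      = ∏ P ∈ S ∩ T, kJ J P := by
    rw [(Phi_gcd S T).pow_pow.dvd_iff_dvd_left, Phi_sq_dvd]
    simp only [kJ]
    rw [Finset.prod_ite_zero]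
    simp
  have h2 : 1 / ((Fintype.card Fq : ℝ) ^
      (EuclideanDomain.lcm (Phi S) (Phi T)).natDegree) ^ 2 = ∏ P ∈ S ∪ T, xN P := by
    rw [Polynomial.natDegree_eq_of_degree_eq
      (Polynomial.degree_eq_degree_of_associated (Phi_lcm S T)), Phi,
      Polynomial.natDegree_prod_of_monic _ _ (fun P _ => P.2.1), ← Finset.prod_pow_eq_pow_sum]
    simp [xN, Finset.prod_pow]
  rw [div_eq_mul_one_div, h1, h2, Phi_mu, Phi_mu]
  simp only [pairTerm, Int.cast_pow, Int.cast_neg, Int.cast_one]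
  congr!

lemma xN_summable [Fintype Fq] : Summable (xN (Fq := Fq)) :=
  poly_summable.comp_injective Subtype.val_injective

lemma xN_bd [Fintype Fq] (P : MPrime Fq) :
    (4 : ℝ) ≤ ((Fintype.card Fq : ℝ) ^ (P : Fq[X]).natDegree) ^ 2 := by
  have h2 : (2 : ℝ) ≤ Fintype.card Fq := by exact_mod_cast Fintype.one_lt_card
  have : (2 : ℝ) ≤ (Fintype.card Fq : ℝ) ^ (P : Fq[X]).natDegree :=
    h2.trans (le_self_pow₀ (by linarith) P.2.2.natDegree_pos.ne')
  nlinarith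

lemma tprod_eq_sing [Fintype Fq] (J : Fq[X]) (hJ : J ≠ 0) :
    ∏' P : MPrime Fq, (1 + (-2 * xN P + kJ J P * xN P)) = singSeries J := by
  let N : Fq[X] → ℝ := fun P => ((Fintype.card Fq : ℝ) ^ P.natDegree) ^ 2
  let c : Fq[X] → ℝ := fun P => if P ^ 2 ∣ J then (N P - 1) / (N P - 2) else 1
  have hfin : Function.HasFiniteMulSupport (fun P : MPrime Fq => c P) := by
    have : (Function.mulSupport fun P : MPrime Fq => c P) ⊆
        Subtype.val ⁻¹' ((UniqueFactorizationMonoid.normalizedFactors J).toFinset : Set Fq[X]) := by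
      intro P hP
      have hd : (P : Fq[X]) ^ 2 ∣ J := by
        by_contra h
        exact hP (by simp [c, h])
      have : (P : Fq[X]) ∈ UniqueFactorizationMonoid.normalizedFactors J :=
        (UniqueFactorizationMonoid.mem_normalizedFactors_iff' hJ).2
          ⟨P.2.2, P.2.1.normalize_eq_self, (dvd_pow_self _ two_ne_zero).trans hd⟩
      exact Multiset.mem_toFinset.2 this
    exact Set.Finite.subset ((Finset.finite_toSet _).preimage Subtype.val_injective.injOn) this
  have h1 : ∏ᶠ P ∈ {P : Fq[X] | P.Monic ∧ Irreducible P ∧ P ^ 2 ∣ J},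
      ((((Fintype.card Fq : ℝ) ^ P.natDegree) ^ 2 - 1) /
        (((Fintype.card Fq : ℝ) ^ P.natDegree) ^ 2 - 2)) = ∏' P : MPrime Fq, c P := by
    rw [tprod_eq_finprod hfin, finprod_subtype_eq_finprod_cond (f := c)]
    refine finprod_congr fun P => ?_
    by_cases h : P.Monic ∧ Irreducible P
    · by_cases h' : P ^ 2 ∣ J
      · simp [h.1, h.2, h', c, N]
      · simp [h', c]
    · have : ¬ (P.Monic ∧ Irreducible P ∧ P ^ 2 ∣ J) := fun g => h ⟨g.1, g.2.1⟩
      simp only [Set.mem_setOf_eq, this, h, finprod_false]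
  rw [singSeries, h1, ← Multipliable.tprod_mul]
  · refine tprod_congr fun P => ?_
    have h4 : 4 ≤ N P := xN_bd P
    have hN2 : N P - 2 ≠ 0 := by linarith
    have hN : N P ≠ 0 := by linarith
    show 1 + (-2 * (1 / N P) + kJ J P * (1 / N P)) = (1 - 2 / N P) * c P
    by_cases h : (P : Fq[X]) ^ 2 ∣ J
    · simp only [kJ, c, h, if_true]
      field_simp
      ring
    · simp only [kJ, c, h, if_false]
      ring
  · refine (Real.multipliable_one_add_of_summable (xN_summable.mul_left (-2))).congr fun P => ?_
    simp only [xN]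
    ring
  · exact multipliable_of_hasFiniteMulSupport hfin

end Poly

open scoped Classical in
/-- for every nonzero `J ∈ 𝔽_q[t]`, the double series over pairs of monic
polynomials satisfies
`∑_{d₁, d₂ monic} μ(d₁)μ(d₂)κ(d₁,d₂;J)/|lcm(d₁,d₂)|² = 𝔖(J)`, where `κ(d₁,d₂;J) = 1` if
`gcd(d₁,d₂)² ∣ J` and `0` otherwise. -/
theorem singular_series_double_sum (Fq : Type) [Field Fq] [Fintype Fq]
    (J : Fq[X]) (hJ : J ≠ 0) :
    (∑' d : {d : Fq[X] // d.Monic} × {d : Fq[X] // d.Monic},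
        (polyMu (d.1 : Fq[X]) : ℝ) * (polyMu (d.2 : Fq[X]) : ℝ) *
          (if (EuclideanDomain.gcd (d.1 : Fq[X]) (d.2 : Fq[X])) ^ 2 ∣ J then (1 : ℝ) else 0) /
          ((Fintype.card Fq : ℝ) ^
              (EuclideanDomain.lcm (d.1 : Fq[X]) (d.2 : Fq[X])).natDegree) ^ 2)
      = singSeries J := by
  let g : Finset (MPrime Fq) × Finset (MPrime Fq) →
      {d : Fq[X] // d.Monic} × {d : Fq[X] // d.Monic} :=
    fun p => (⟨Phi p.1, Phi_monic _⟩, ⟨Phi p.2, Phi_monic _⟩)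
  have hg : Function.Injective g := by
    rintro ⟨S, T⟩ ⟨S', T'⟩ h
    simp only [g, Prod.mk.injEq, Subtype.mk.injEq] at h
    rw [Phi_inj h.1, Phi_inj h.2]
  rw [← tprod_eq_sing J hJ, ← pairTerm_tsum (kJ J) xN
    (fun P => by unfold kJ; split_ifs <;> norm_num)
    (fun P => by unfold kJ; split_ifs <;> norm_num)
    (fun P => by unfold xN; positivity) xN_summable, ← hg.tsum_eq]
  · exact tsum_congr fun p => Phi_term J p.1 p.2
  · rintro ⟨⟨d, hd⟩, ⟨e, he⟩⟩ h
    have h1 : Squarefree d := by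
      by_contra hc
      exact h (by simp [polyMu, hc])
    have h2 : Squarefree e := by
      by_contra hc
      exact h (by simp [polyMu, hc])
    obtain ⟨S, hS⟩ := Phi_surj hd h1
    obtain ⟨T, hT⟩ := Phi_surj he h2
    exact ⟨(S, T), by simp [g, hS, hT]⟩
end
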